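/- Let V be a MOSVA and W a V-bimodule, both satisfying the pole-order condition. Let v_1, v_2 ∈ V and let f ∈ W̃_{z_3,…,z_{n+2}} be a \overline{W}-valued rational function such that for every (z_1,…,z_{n+2}) ∈ F_{n+2}ℂ with |z_1| > |z_2| > |z_i| for i = 3,…,n+2, the series Y_W^L(v_1,z_1)Y_W^L(v_2,z_2)f(z_3,…,z_{n+2}) converges absolutely to a \overline{W}-valued rational function. Then for every (z_1,…,z_{n+2}) ∈ F_{n+2}ℂ with |z_2| > |z_1−z_2| + |z_i| for i = 3,…,n+2, the series Y_W^L(Y_V(v_1,z_1−z_2)v_2, z_2)f(z_3,…,z_{n+2}) also converges absolutely to the same \overline{W}-valued rational function. -/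

import Mathlib

set_option autoImplicit false
set_option maxHeartbeats 1000000

open scoped BigOperators

noncomputable section

namespace VA

/-- Absolute convergence of a series of complex numbers indexed by `ι` to the sum `s`. -/
def AbsConvTo {ι : Type*} (f : ι → ℂ) (s : ℂ) : Prop :=
  Summable (fun i => ‖f i‖) ∧ HasSum f s

/-- The configuration-space condition: the entries of `z` are pairwise distinct. -/
def Conf {ι : Type*} (z : ι → ℂ) : Prop := ∀ i j : ι, i ≠ j → z i ≠ z j

/-- `‖z 0‖ > ‖z 1‖ > ⋯ > ‖z (n-1)‖`. -/
def Ordered {n : ℕ} (z : Fin n → ℂ) : Prop := ∀ i j : Fin n, i < j → ‖z j‖ < ‖z i‖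

/-- `‖z 0‖ > ‖z 1‖ > ⋯ > ‖z (n-1)‖ > 0`. -/
def OrderedPos {n : ℕ} (z : Fin n → ℂ) : Prop := Ordered z ∧ ∀ i, 0 < ‖z i‖

/-- A rational function in the variables `z i`, `i : ι`, whose only possible poles are
at `z i = 0` and on the diagonals `z i = z j` (`i ≠ j`); it is recorded as a numerator
polynomial together with the orders of the poles. -/
structure RatFn (ι : Type*) [Fintype ι] [DecidableEq ι] where
  num : MvPolynomial ι ℂ
  a : ι → ℕ
  b : ι → ι → ℕ

def RatFn.eval {ι : Type*} [Fintype ι] [DecidableEq ι] (R : RatFn ι) (z : ι → ℂ) : ℂ :=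
  MvPolynomial.eval z R.num /
    ((∏ i, z i ^ R.a i) * ∏ q ∈ Finset.univ.offDiag, (z q.1 - z q.2) ^ R.b q.1 q.2)

/-- A rational function in the variables `z i`, `i : ι`, whose only possible poles are
on the diagonals `z i = z j` (`i ≠ j`). -/
structure DiagRatFn (ι : Type*) [Fintype ι] [DecidableEq ι] where
  num : MvPolynomial ι ℂ
  b : ι → ι → ℕ

def DiagRatFn.eval {ι : Type*} [Fintype ι] [DecidableEq ι] (R : DiagRatFn ι) (z : ι → ℂ) : ℂ :=
  MvPolynomial.eval z R.num / ∏ q ∈ Finset.univ.offDiag, (z q.1 - z q.2) ^ R.b q.1 q.2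

/-- A linear functional belongs to the graded dual iff its restriction to all but
finitely many homogeneous components vanishes. -/
def InGradedDual {ι : Type*} {M : Type*} [AddCommGroup M] [Module ℂ M]
    (proj : ι → M →ₗ[ℂ] M) (φ : M →ₗ[ℂ] ℂ) : Prop :=
  (Function.support fun i => φ ∘ₗ proj i).Finite

/-- Iterated application: `compApply n f w = f 0 (f 1 (⋯ (f (n-1) w)))`. -/
def compApply {M : Type*} : (n : ℕ) → (Fin n → (M → M)) → M → M
  | 0, _, w => w
  | n+1, f, w => f 0 (compApply n (fun i => f i.succ) w)

section Graded

variable (W : Type*) [AddCommGroup W] [Module ℂ W]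

/-- A `ℂ`-grading of `W`, recorded via the projections onto the homogeneous
subspaces, whose weights have lower-bounded real parts. -/
structure CGrading where
  proj : ℂ → W →ₗ[ℂ] W
  proj_comp : ∀ m n : ℂ, proj m ∘ₗ proj n = if m = n then proj n else 0
  proj_finite : ∀ w : W, (Function.support fun n => proj n w).Finite
  proj_sum : ∀ w : W, (∑ᶠ n : ℂ, proj n w) = w
  lower_bound : ∃ B : ℝ, ∀ n : ℂ, n.re < B → proj n = 0

/-- A `ℤ`-grading of `V` with lower-bounded weights. -/
structure ZGrading where
  proj : ℤ → W →ₗ[ℂ] W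
  proj_comp : ∀ m n : ℤ, proj m ∘ₗ proj n = if m = n then proj n else 0
  proj_finite : ∀ w : W, (Function.support fun n => proj n w).Finite
  proj_sum : ∀ w : W, (∑ᶠ n : ℤ, proj n w) = w
  lower_bound : ∃ B : ℤ, ∀ n : ℤ, n < B → proj n = 0

variable {W}

/-- The grading operator `d` of a `ℂ`-graded space. -/
def CGrading.d (G : CGrading W) (w : W) : W := ∑ᶠ n : ℂ, n • G.proj n w

/-- The grading operator `d` of a `ℤ`-graded space. -/
def ZGrading.d (G : ZGrading W) (v : W) : W := ∑ᶠ n : ℤ, (n : ℂ) • G.proj n v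

/-- The operator `z^d` on a `ℤ`-graded space. -/
def ZGrading.zd (G : ZGrading W) (z : ℂ) (v : W) : W := ∑ᶠ n : ℤ, (z ^ n) • G.proj n v

/-- The algebraic completion `∏ₙ W_[n]`, realized as the submodule of functions
`ℂ → W` recording a homogeneous component in each weight. -/
def CGrading.compSub (G : CGrading W) : Submodule ℂ (ℂ → W) where
  carrier := {f | ∀ n, G.proj n (f n) = f n}
  add_mem' := by
    intro a b ha hb n
    simp only [Pi.add_apply, map_add, ha n, hb n]
  zero_mem' := by
    intro n
    simp
  smul_mem' := by
    intro c f hf n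
    simp only [Pi.smul_apply, map_smul, hf n]

/-- The algebraic completion of a graded space. -/
abbrev CGrading.Comp (G : CGrading W) : Type _ := ↥G.compSub

/-- The pairing between the graded dual and the algebraic completion. -/
def CGrading.pair (G : CGrading W) (φ : W →ₗ[ℂ] ℂ) (f : G.Comp) : ℂ :=
  ∑ᶠ n : ℂ, φ (f.1 n)

/-- The embedding of `W` into its algebraic completion. -/
def CGrading.emb (G : CGrading W) (w : W) : G.Comp :=
  ⟨fun n => G.proj n w, by
    intro n
    have h := congrArg (fun T : W →ₗ[ℂ] W => T w) (G.proj_comp n n)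
    simpa using h⟩

/-- The componentwise extension of an operator on `W` to the algebraic completion. -/
def CGrading.ext (G : CGrading W) (L : W → W) (f : G.Comp) : G.Comp :=
  ⟨fun m => ∑ᶠ n : ℂ, G.proj m (L (f.1 n)), by
    intro m
    show G.proj m (∑ᶠ n : ℂ, G.proj m (L (f.1 n))) = ∑ᶠ n : ℂ, G.proj m (L (f.1 n))
    by_cases h : (Function.support fun n => G.proj m (L (f.1 n))).Finite
    · have h1 := AddMonoidHom.map_finsum (G.proj m).toAddMonoidHom h
      simp only [LinearMap.toAddMonoidHom_coe] at h1
      rw [h1]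
      refine finsum_congr fun n => ?_
      have h2 := congrArg (fun T : W →ₗ[ℂ] W => T (L (f.1 n))) (G.proj_comp m m)
      simpa using h2
    · rw [finsum_of_infinite_support h]
      simp⟩

/-- The operator `z^d` on the algebraic completion, acting on the component of
weight `n` by `z ^ n` (complex power). -/
def CGrading.zd (G : CGrading W) (z : ℂ) (f : G.Comp) : G.Comp :=
  ⟨fun n => (z ^ n) • f.1 n, by
    intro n
    rw [map_smul, f.2 n]⟩

end Graded


section VOA

/-- A meromorphic open-string vertex algebra (MOSVA): a lower-bounded `ℤ`-graded
space with a vertex operator map (recorded through its coefficients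
`Y u v k = (Y_V)_k(u)v`, the coefficient of `x^{-k-1}` in `Y_V(u,x)v`) and a
vacuum, satisfying the grading, vacuum, `D`-derivative/commutator, rationality and
associativity axioms. -/
structure MOSVA (V : Type*) [AddCommGroup V] [Module ℂ V] where
  gr : ZGrading V
  Y : V →ₗ[ℂ] V →ₗ[ℂ] (ℤ → V)
  vac : V
  /-- lower truncation of vertex operators -/
  trunc : ∀ u v : V, ∃ N : ℤ, ∀ k : ℤ, N ≤ k → Y u v k = 0
  /-- identity property `Y(𝟏,x) = 1` -/
  identity : ∀ (v : V) (k : ℤ), Y vac v k = if k = -1 then v else 0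
  /-- creation property: `Y(u,x)𝟏 ∈ V[[x]]` and `lim_{x→0} Y(u,x)𝟏 = u` -/
  creation : ∀ (u : V) (k : ℤ), 0 ≤ k → Y u vac k = 0
  creation_lim : ∀ u : V, Y u vac (-1) = u
  /-- the `d`-commutator formula, written in terms of coefficients -/
  d_comm : ∀ (u v : V) (k : ℤ),
    gr.d (Y u v k) = Y (gr.d u) v k + (-(k : ℂ) - 1) • Y u v k + Y u (gr.d v) k
  /-- the `D`-derivative property (`D_V u = (Y_V)_{-2}(u)𝟏`) -/
  D_deriv : ∀ (u v : V) (k : ℤ),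
    Y (Y u vac (-2)) v k = (-(k : ℂ)) • Y u v (k - 1)
  /-- the `D`-commutator formula -/
  D_comm : ∀ (u v : V) (k : ℤ),
    Y (Y u v k) vac (-2) - Y u (Y v vac (-2)) k = (-(k : ℂ)) • Y u v (k - 1)
  /-- rationality of products: matrix coefficients of products of vertex operators
  converge absolutely in the ordered region to rational functions with the only
  possible poles at `z i = 0` and `z i = z j` -/
  rationality : ∀ (n : ℕ) (u : Fin n → V) (v : V) (φ : V →ₗ[ℂ] ℂ),
    InGradedDual gr.proj φ → ∃ R : RatFn (Fin n), ∀ z : Fin n → ℂ, OrderedPos z →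
      AbsConvTo (fun k : Fin n → ℤ =>
          φ (compApply n (fun i x => Y (u i) x (k i)) v) * ∏ i, z i ^ (-(k i) - 1))
        (R.eval z)
  /-- rationality of iterates and associativity: products and iterates converge to a
  common rational function -/
  associativity : ∀ (u₁ u₂ v : V) (φ : V →ₗ[ℂ] ℂ), InGradedDual gr.proj φ →
    ∃ R : RatFn (Fin 2),
      (∀ z₁ z₂ : ℂ, ‖z₂‖ < ‖z₁‖ → 0 < ‖z₂‖ →
        AbsConvTo (fun k : ℤ × ℤ =>
            φ (Y u₁ (Y u₂ v k.2) k.1) * z₁ ^ (-k.1 - 1) * z₂ ^ (-k.2 - 1))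
          (R.eval ![z₁, z₂])) ∧
      (∀ z₁ z₂ : ℂ, ‖z₁ - z₂‖ < ‖z₂‖ → 0 < ‖z₁ - z₂‖ →
        AbsConvTo (fun k : ℤ × ℤ =>
            φ (Y (Y u₁ u₂ k.1) v k.2) * (z₁ - z₂) ^ (-k.1 - 1) * z₂ ^ (-k.2 - 1))
          (R.eval ![z₁, z₂]))

variable {V : Type*} [AddCommGroup V] [Module ℂ V]

/-- The operator `D_V`. -/
def MOSVA.D (A : MOSVA V) (v : V) : V := A.Y v A.vac (-2)

/-- The pole-order condition for a MOSVA. -/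
def MOSVA.PoleOrder (A : MOSVA V) : Prop :=
  ∀ u₁ v : V, ∃ C : ℕ, ∀ φ : V →ₗ[ℂ] ℂ, InGradedDual A.gr.proj φ → ∀ u₂ : V,
    ∃ R : RatFn (Fin 2), R.a 0 ≤ C ∧
      ∀ z₁ z₂ : ℂ, ‖z₂‖ < ‖z₁‖ → 0 < ‖z₂‖ →
        AbsConvTo (fun k : ℤ × ℤ =>
            φ (A.Y u₁ (A.Y u₂ v k.2) k.1) * z₁ ^ (-k.1 - 1) * z₂ ^ (-k.2 - 1))
          (R.eval ![z₁, z₂])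

/-- A bimodule for a MOSVA: a `ℂ`-graded space with left and right vertex operator
maps (recorded through their coefficients), satisfying the left module, right module
and compatibility axioms. -/
structure Bimod (A : MOSVA V) (W : Type*) [AddCommGroup W] [Module ℂ W] where
  gr : CGrading W
  YL : V →ₗ[ℂ] W →ₗ[ℂ] (ℤ → W)
  YR : W →ₗ[ℂ] V →ₗ[ℂ] (ℤ → W)
  DW : W →ₗ[ℂ] W
  /-- `D_W` has weight one -/
  DW_wt : ∀ n : ℂ, DW ∘ₗ gr.proj n = gr.proj (n + 1) ∘ₗ DW ∘ₗ gr.proj n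
  truncL : ∀ (u : V) (w : W), ∃ N : ℤ, ∀ k : ℤ, N ≤ k → YL u w k = 0
  truncR : ∀ (w : W) (u : V), ∃ N : ℤ, ∀ k : ℤ, N ≤ k → YR w u k = 0
  identityL : ∀ (w : W) (k : ℤ), YL A.vac w k = if k = -1 then w else 0
  creationR : ∀ (w : W) (k : ℤ), 0 ≤ k → YR w A.vac k = 0
  creationR_lim : ∀ w : W, YR w A.vac (-1) = w
  d_commL : ∀ (u : V) (w : W) (k : ℤ),
    gr.d (YL u w k) = YL (A.gr.d u) w k + (-(k : ℂ) - 1) • YL u w k + YL u (gr.d w) k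
  d_commR : ∀ (w : W) (u : V) (k : ℤ),
    gr.d (YR w u k) = YR (gr.d w) u k + (-(k : ℂ) - 1) • YR w u k + YR w (A.gr.d u) k
  D_derivL : ∀ (u : V) (w : W) (k : ℤ),
    YL (A.D u) w k = (-(k : ℂ)) • YL u w (k - 1)
  D_commL : ∀ (u : V) (w : W) (k : ℤ),
    DW (YL u w k) - YL u (DW w) k = (-(k : ℂ)) • YL u w (k - 1)
  D_derivR : ∀ (w : W) (u : V) (k : ℤ),
    YR (DW w) u k = (-(k : ℂ)) • YR w u (k - 1)
  D_commR : ∀ (w : W) (u : V) (k : ℤ),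
    DW (YR w u k) - YR w (A.D u) k = (-(k : ℂ)) • YR w u (k - 1)
  /-- rationality for products of left vertex operators -/
  rationalityL : ∀ (n : ℕ) (u : Fin n → V) (w : W) (φ : W →ₗ[ℂ] ℂ),
    InGradedDual gr.proj φ → ∃ R : RatFn (Fin n), ∀ z : Fin n → ℂ, OrderedPos z →
      AbsConvTo (fun k : Fin n → ℤ =>
          φ (compApply n (fun i x => YL (u i) x (k i)) w) * ∏ i, z i ^ (-(k i) - 1))
        (R.eval z)
  /-- rationality of iterates and associativity for the left vertex operator map -/
  associativityL : ∀ (u₁ u₂ : V) (w : W) (φ : W →ₗ[ℂ] ℂ), InGradedDual gr.proj φ →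
    ∃ R : RatFn (Fin 2),
      (∀ z₁ z₂ : ℂ, ‖z₂‖ < ‖z₁‖ → 0 < ‖z₂‖ →
        AbsConvTo (fun k : ℤ × ℤ =>
            φ (YL u₁ (YL u₂ w k.2) k.1) * z₁ ^ (-k.1 - 1) * z₂ ^ (-k.2 - 1))
          (R.eval ![z₁, z₂])) ∧
      (∀ z₁ z₂ : ℂ, ‖z₁ - z₂‖ < ‖z₂‖ → 0 < ‖z₁ - z₂‖ →
        AbsConvTo (fun k : ℤ × ℤ =>
            φ (YL (A.Y u₁ u₂ k.1) w k.2) * (z₁ - z₂) ^ (-k.1 - 1) * z₂ ^ (-k.2 - 1))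
          (R.eval ![z₁, z₂]))
  /-- rationality for products `Y_W^R(w,z₁)Y_V(u₁,z₂)⋯Y_V(u_{n-1},z_n)u_n` -/
  rationalityR : ∀ (n : ℕ) (w : W) (v : Fin (n+1) → V) (φ : W →ₗ[ℂ] ℂ),
    InGradedDual gr.proj φ → ∃ R : RatFn (Fin (n+1)),
      ∀ z : Fin (n+1) → ℂ, OrderedPos z →
        AbsConvTo (fun k : Fin (n+1) → ℤ =>
            φ (YR w (compApply n (fun i x => A.Y (v i.castSucc) x (k i.succ))
                (v (Fin.last n))) (k 0)) * ∏ i, z i ^ (-(k i) - 1))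
          (R.eval z)
  /-- rationality of iterates and associativity for the right vertex operator map -/
  associativityR : ∀ (w : W) (u₁ u₂ : V) (φ : W →ₗ[ℂ] ℂ), InGradedDual gr.proj φ →
    ∃ R : RatFn (Fin 2),
      (∀ z₁ z₂ : ℂ, ‖z₂‖ < ‖z₁‖ → 0 < ‖z₂‖ →
        AbsConvTo (fun k : ℤ × ℤ =>
            φ (YR w (A.Y u₁ u₂ k.2) k.1) * z₁ ^ (-k.1 - 1) * z₂ ^ (-k.2 - 1))
          (R.eval ![z₁, z₂])) ∧
      (∀ z₁ z₂ : ℂ, ‖z₁ - z₂‖ < ‖z₂‖ → 0 < ‖z₁ - z₂‖ →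
        AbsConvTo (fun k : ℤ × ℤ =>
            φ (YR (YR w u₁ k.1) u₂ k.2) * (z₁ - z₂) ^ (-k.1 - 1) * z₂ ^ (-k.2 - 1))
          (R.eval ![z₁, z₂]))
  /-- compatibility: rationality of mixed products
  `Y_W^L(u₁,z₁)⋯Y_W^L(u_p,z_p)Y_W^R(w,z₀)Y_V(v₁,⋅)⋯Y_V(v_{q},⋅)v_{q+1}` -/
  compatRat : ∀ (p q : ℕ) (u : Fin p → V) (w : W) (v : Fin (q+1) → V)
      (φ : W →ₗ[ℂ] ℂ), InGradedDual gr.proj φ →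
    ∃ R : RatFn (Fin p ⊕ Fin (q+1)),
      ∀ (zL : Fin p → ℂ) (z0 : ℂ) (zR : Fin q → ℂ),
        Ordered zL → (∀ i, ‖z0‖ < ‖zL i‖) → (∀ j, ‖zR j‖ < ‖z0‖) → Ordered zR →
        0 < ‖z0‖ → (∀ j, 0 < ‖zR j‖) →
        AbsConvTo (fun K : (Fin p → ℤ) × ℤ × (Fin q → ℤ) =>
            φ (compApply p (fun i x => YL (u i) x (K.1 i))
                (YR w (compApply q (fun j x => A.Y (v j.castSucc) x (K.2.2 j))
                  (v (Fin.last q))) K.2.1))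
              * (∏ i, zL i ^ (-(K.1 i) - 1)) * z0 ^ (-K.2.1 - 1)
              * ∏ j, zR j ^ (-(K.2.2 j) - 1))
          (R.eval (Sum.elim zL (Fin.cons z0 zR)))
  /-- compatibility: associativity for the left and right vertex operator maps -/
  compatAssoc : ∀ (u v : V) (w : W) (φ : W →ₗ[ℂ] ℂ), InGradedDual gr.proj φ →
    ∃ R : RatFn (Fin 2),
      (∀ z₁ z₂ : ℂ, ‖z₂‖ < ‖z₁‖ → 0 < ‖z₂‖ →
        AbsConvTo (fun k : ℤ × ℤ =>
            φ (YL u (YR w v k.2) k.1) * z₁ ^ (-k.1 - 1) * z₂ ^ (-k.2 - 1))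
          (R.eval ![z₁, z₂])) ∧
      (∀ z₁ z₂ : ℂ, ‖z₁ - z₂‖ < ‖z₂‖ → 0 < ‖z₁ - z₂‖ →
        AbsConvTo (fun k : ℤ × ℤ =>
            φ (YR (YL u w k.1) v k.2) * (z₁ - z₂) ^ (-k.1 - 1) * z₂ ^ (-k.2 - 1))
          (R.eval ![z₁, z₂]))

variable {W : Type*} [AddCommGroup W] [Module ℂ W] {A : MOSVA V}

/-- The opposite right vertex operator map
`Y_W^{s(R)}(v,x)w = e^{xD_W}Y_W^R(w,-x)v`, through its coefficients. -/
def Bimod.YsR (B : Bimod A W) (v : V) (w : W) (k : ℤ) : W :=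
  ∑ᶠ m : ℕ, (((-1 : ℂ) ^ (k + (m : ℤ) + 1)) * ((m.factorial : ℂ))⁻¹) •
    ((B.DW ^ m) (B.YR w v (k + (m : ℤ))))

/-- The pole-order condition for a bimodule over a MOSVA. -/
def Bimod.PoleOrder (B : Bimod A W) : Prop :=
  (∀ (u₁ : V) (w : W), ∃ C : ℕ, ∀ φ : W →ₗ[ℂ] ℂ, InGradedDual B.gr.proj φ → ∀ u₂ : V,
    ∃ R : RatFn (Fin 2), R.a 0 ≤ C ∧
      ∀ z₁ z₂ : ℂ, ‖z₂‖ < ‖z₁‖ → 0 < ‖z₂‖ →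
        AbsConvTo (fun k : ℤ × ℤ =>
            φ (B.YL u₁ (B.YL u₂ w k.2) k.1) * z₁ ^ (-k.1 - 1) * z₂ ^ (-k.2 - 1))
          (R.eval ![z₁, z₂])) ∧
  (∀ (u₂ : V) (w : W), ∃ C : ℕ, ∀ φ : W →ₗ[ℂ] ℂ, InGradedDual B.gr.proj φ → ∀ u₁ : V,
    ∃ R : RatFn (Fin 2), R.a 0 ≤ C ∧
      ∀ z₁ z₂ : ℂ, ‖z₂‖ < ‖z₁‖ → 0 < ‖z₂‖ →
        AbsConvTo (fun k : ℤ × ℤ =>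
            φ (B.YR w (A.Y u₁ u₂ k.2) k.1) * z₁ ^ (-k.1 - 1) * z₂ ^ (-k.2 - 1))
          (R.eval ![z₁, z₂])) ∧
  (∀ (u₁ u₂ : V), ∃ C : ℕ, ∀ φ : W →ₗ[ℂ] ℂ, InGradedDual B.gr.proj φ → ∀ w : W,
    ∃ R : RatFn (Fin 2), R.a 0 ≤ C ∧
      ∀ z₁ z₂ : ℂ, ‖z₂‖ < ‖z₁‖ → 0 < ‖z₂‖ →
        AbsConvTo (fun k : ℤ × ℤ =>
            φ (B.YL u₁ (B.YR w u₂ k.2) k.1) * z₁ ^ (-k.1 - 1) * z₂ ^ (-k.2 - 1))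
          (R.eval ![z₁, z₂]))

end VOA


section Cochains

variable {V : Type*} [AddCommGroup V] [Module ℂ V]
variable {W : Type*} [AddCommGroup W] [Module ℂ W] {A : MOSVA V}

/-- A `W̄`-valued rational function in the variables `z i`, `i : ι`, with the only
possible poles at `z i = z j`: a map from configuration space to the algebraic
completion whose pairings with graded-dual functionals are such rational functions,
with pole orders uniform in the functional, as witnessed by a formal power series
with coefficients in `W` (condition (ii)). -/
def CGrading.WTilde (G : CGrading W) {ι : Type*} [Fintype ι] [DecidableEq ι]
    (f : (ι → ℂ) → G.Comp) : Prop :=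
  (∀ φ : W →ₗ[ℂ] ℂ, InGradedDual G.proj φ →
      ∃ R : DiagRatFn ι, ∀ z : ι → ℂ, Conf z → G.pair φ (f z) = R.eval z) ∧
  ∃ (p : ι → ι → ℤ) (b : (ι → ℕ) → W),
    ∀ φ : W →ₗ[ℂ] ℂ, InGradedDual G.proj φ →
      (Function.support fun k => φ (b k)).Finite ∧
      ∀ z : ι → ℂ, Conf z →
        (∏ q ∈ Finset.univ.offDiag, (z q.1 - z q.2) ^ (p q.1 q.2)) * G.pair φ (f z)
          = ∑ᶠ k : ι → ℕ, φ (b k) * ∏ i, z i ^ (k i)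

/-- The pattern of left/right vertex operators: the `i`-th operator is
`Y_W^L(u i, z i)` if `isL i`, and `Y_W^{s(R)}(u i, z i)` otherwise; `k` records the
coefficient extracted from each operator. -/
def patOps (B : Bimod A W) {n : ℕ} (isL : Fin n → Bool) (u : Fin n → V)
    (k : Fin n → ℤ) : Fin n → (W → W) :=
  fun i => if isL i then fun x => B.YL (u i) x (k i) else fun x => B.YsR (u i) x (k i)

/-- The pattern with `l` left operators followed by `n - l` opposite right operators. -/
def prefixPat (n l : ℕ) : Fin n → Bool := fun i => decide ((i : ℕ) < l)

/-- A vector `w` such that `Y_W^L(u,x)w ∈ W[[x]]` and `Y_W^{s(R)}(u,x)w ∈ W[[x]]`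
for every `u ∈ V`. -/
def Bimod.RegVec (B : Bimod A W) (w : W) : Prop :=
  ∀ (u : V) (k : ℤ), 0 ≤ k → B.YL u w k = 0 ∧ B.YsR u w k = 0

/-- `f` represents the `W̄`-valued rational function
`E(Y^{L/sR}(u 0, z 0)⋯Y^{L/sR}(u (n-1), z (n-1)) w)` (with the operators prescribed
by the pattern `isL`): `f` is a `W̄`-valued rational function with only diagonal
poles whose pairings are the sums of the corresponding series of matrix coefficients
on the region `|z 0| > ⋯ > |z (n-1)| > 0`. -/
def RepEPat (B : Bimod A W) {n : ℕ} (isL : Fin n → Bool) (u : Fin n → V) (w : W)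
    (f : (Fin n → ℂ) → B.gr.Comp) : Prop :=
  B.gr.WTilde f ∧
  ∀ φ : W →ₗ[ℂ] ℂ, InGradedDual B.gr.proj φ → ∀ z : Fin n → ℂ, OrderedPos z →
    AbsConvTo (fun k : Fin n → ℤ =>
        φ (compApply n (patOps B isL u k) w) * ∏ i, z i ^ (-(k i) - 1))
      (B.gr.pair φ (f z))

/-- `f` represents the `W̄`-valued rational function given by a product of groups of
vertex operators, with group `i` of size `α i` and left/right pattern `isL`;
the variables are indexed by the sigma type `(i : Fin N) × Fin (α i)`. -/
def RepESig (B : Bimod A W) {N : ℕ} (α : Fin N → ℕ)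
    (isL : (i : Fin N) → Fin (α i) → Bool)
    (u : (i : Fin N) → Fin (α i) → V) (w : W)
    (f : (((i : Fin N) × Fin (α i)) → ℂ) → B.gr.Comp) : Prop :=
  B.gr.WTilde f ∧
  ∀ φ : W →ₗ[ℂ] ℂ, InGradedDual B.gr.proj φ →
    ∀ Z : (i : Fin N) → Fin (α i) → ℂ,
      (∀ (i : Fin N) (s t : Fin (α i)), s < t → ‖Z i t‖ < ‖Z i s‖) →
      (∀ (i j : Fin N), i < j → ∀ (s : Fin (α i)) (t : Fin (α j)), ‖Z j t‖ < ‖Z i s‖) →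
      (∀ (i : Fin N) (s : Fin (α i)), 0 < ‖Z i s‖) →
      AbsConvTo (fun K : (i : Fin N) → Fin (α i) → ℤ =>
          φ (compApply N (fun i x => compApply (α i) (fun s y =>
              if isL i s then B.YL (u i s) y (K i s) else B.YsR (u i s) y (K i s)) x) w)
            * ∏ i, ∏ s, Z i s ^ (-(K i s) - 1))
        (B.gr.pair φ (f (fun q => Z q.1 q.2)))

/-- Multilinearity of a map on `n`-tuples of vectors. -/
def IsMultilinear {M : Type*} [AddCommMonoid M] [Module ℂ M] {n : ℕ}
    (Φ : (Fin n → V) → M) : Prop :=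
  (∀ (v : Fin n → V) (i : Fin n) (x y : V),
      Φ (Function.update v i (x + y)) = Φ (Function.update v i x) + Φ (Function.update v i y)) ∧
  ∀ (v : Fin n → V) (i : Fin n) (c : ℂ) (x : V),
      Φ (Function.update v i (c • x)) = c • Φ (Function.update v i x)

/-- The `D`-derivative property of a map `Φ : V^{⊗n} → W̃_{z₁,…,zₙ}`. -/
def DDerivProp (A : MOSVA V) (B : Bimod A W) {n : ℕ}
    (Φ : (Fin n → V) → (Fin n → ℂ) → B.gr.Comp) : Prop :=
  (∀ (v : Fin n → V) (i : Fin n) (φ : W →ₗ[ℂ] ℂ), InGradedDual B.gr.proj φ →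
    ∀ z : Fin n → ℂ, Conf z →
      HasDerivAt (fun t : ℂ => B.gr.pair φ (Φ v (Function.update z i t)))
        (B.gr.pair φ (Φ (Function.update v i (A.D (v i))) z)) (z i)) ∧
  (∀ (v : Fin n → V) (φ : W →ₗ[ℂ] ℂ), InGradedDual B.gr.proj φ →
    ∀ z : Fin n → ℂ, Conf z →
      B.gr.pair φ (B.gr.ext (⇑B.DW) (Φ v z)) =
        ∑ i, B.gr.pair φ (Φ (Function.update v i (A.D (v i))) z))

/-- The `d`-conjugation property of a map `Φ : V^{⊗n} → W̃_{z₁,…,zₙ}`. -/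
def DConjProp (A : MOSVA V) (B : Bimod A W) {n : ℕ}
    (Φ : (Fin n → V) → (Fin n → ℂ) → B.gr.Comp) : Prop :=
  ∀ (v : Fin n → V) (φ : W →ₗ[ℂ] ℂ), InGradedDual B.gr.proj φ →
    ∀ (z : Fin n → ℂ) (c : ℂ), c ≠ 0 → Conf z → Conf (fun i => c * z i) →
      B.gr.pair φ (B.gr.zd c (Φ v z)) =
        B.gr.pair φ (Φ (fun i => A.gr.zd c (v i)) (fun i => c * z i))

/-- Composability of `Φ : V^{⊗n} → W̃` with `m` vertex operators. -/
def ComposableWith (A : MOSVA V) (B : Bimod A W) (n m : ℕ)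
    (Φ : (Fin n → V) → (Fin n → ℂ) → B.gr.Comp) : Prop :=
  ∃ Cb : V → V → ℕ,
  ∀ (α : Fin (n+1) → ℕ), (∑ i, α i) = m + n →
  ∀ l₀ : ℕ, l₀ ≤ α 0 →
  ∀ u : (i : Fin (n+1)) → Fin (α i) → V,
  ∀ φ : W →ₗ[ℂ] ℂ, InGradedDual B.gr.proj φ →
  ∃ R : DiagRatFn ((i : Fin (n+1)) × Fin (α i)),
    (∀ q q' : (i : Fin (n+1)) × Fin (α i), R.b q q' ≤ Cb (u q.1 q.2) (u q'.1 q'.2)) ∧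
    ∀ (z : (i : Fin (n+1)) → Fin (α i) → ℂ) (ζ : Fin n → ℂ),
      (∀ s t : Fin (α 0), s < t → ‖z 0 t‖ < ‖z 0 s‖) →
      (∀ (j : Fin (α 0)) (i : Fin n) (t : Fin (α i.succ)),
          ‖ζ i‖ + ‖z i.succ t - ζ i‖ < ‖z 0 j‖) →
      (∀ (i : Fin n) (s t : Fin (α i.succ)), s < t →
          ‖z i.succ t - ζ i‖ < ‖z i.succ s - ζ i‖) →
      (∀ (i j : Fin n), i < j → ∀ (s : Fin (α i.succ)) (t : Fin (α j.succ)),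
          ‖(z i.succ s - ζ i) - (z j.succ t - ζ j)‖ < ‖ζ i - ζ j‖) →
      AbsConvTo (fun K : (i : Fin (n+1)) → Fin (α i) → ℤ =>
          B.gr.pair φ
            (compApply (α 0) (fun j => B.gr.ext (fun x =>
                if (j : ℕ) < l₀ then B.YL (u 0 j) x (K 0 j) else B.YsR (u 0 j) x (K 0 j)))
              (Φ (fun i => compApply (α i.succ)
                    (fun s x => A.Y (u i.succ s) x (K i.succ s)) A.vac) ζ))
            * (∏ j, z 0 j ^ (-(K 0 j) - 1))
            * ∏ i : Fin n, ∏ s, (z i.succ s - ζ i) ^ (-(K i.succ s) - 1))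
        (R.eval (fun q => z q.1 q.2))

/-- The set `Ĉ^n_m(V,W)`: maps `V^{⊗n} → W̃_{z₁,…,zₙ}` that are linear, satisfy the
`D`-derivative and `d`-conjugation properties and are composable with `m` vertex
operators. -/
def IsCochain (A : MOSVA V) (B : Bimod A W) (n m : ℕ)
    (Φ : (Fin n → V) → (Fin n → ℂ) → B.gr.Comp) : Prop :=
  IsMultilinear Φ ∧ (∀ v, B.gr.WTilde (Φ v)) ∧ DDerivProp A B Φ ∧ DConjProp A B Φ ∧
    ComposableWith A B n m Φ

/-- `Ψ` represents `E_W^{(1,0)} ∘₂ Φ`, i.e. the map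
`v ↦ E(Y_W^L(v 0, z 0) Φ(v 1 ⊗ ⋯ ⊗ v n)(z 1,…,z n))`. -/
def RepLeft (A : MOSVA V) (B : Bimod A W) {n : ℕ}
    (Φ : (Fin n → V) → (Fin n → ℂ) → B.gr.Comp)
    (Ψ : (Fin (n+1) → V) → (Fin (n+1) → ℂ) → B.gr.Comp) : Prop :=
  (∀ v, B.gr.WTilde (Ψ v)) ∧
  ∀ (v : Fin (n+1) → V) (φ : W →ₗ[ℂ] ℂ), InGradedDual B.gr.proj φ →
    ∀ (z₀ : ℂ) (zt : Fin n → ℂ), Conf (Fin.cons z₀ zt) →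
      (∀ i, ‖zt i‖ < ‖z₀‖) → (∀ i, 0 < ‖zt i‖) →
      AbsConvTo (fun k : ℤ =>
          B.gr.pair φ (B.gr.ext (fun x => B.YL (v 0) x k) (Φ (Fin.tail v) zt))
            * z₀ ^ (-k - 1))
        (B.gr.pair φ (Ψ v (Fin.cons z₀ zt)))

/-- `Ψ` represents `E_W^{(0,1)} ∘₂ Φ`, i.e. the map
`v ↦ E(Y_W^{s(R)}(v (n+1), z (n+1)) Φ(v 1 ⊗ ⋯ ⊗ v n)(z 1,…,z n))`. -/
def RepRight (A : MOSVA V) (B : Bimod A W) {n : ℕ}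
    (Φ : (Fin n → V) → (Fin n → ℂ) → B.gr.Comp)
    (Ψ : (Fin (n+1) → V) → (Fin (n+1) → ℂ) → B.gr.Comp) : Prop :=
  (∀ v, B.gr.WTilde (Ψ v)) ∧
  ∀ (v : Fin (n+1) → V) (φ : W →ₗ[ℂ] ℂ), InGradedDual B.gr.proj φ →
    ∀ (zl : ℂ) (zi : Fin n → ℂ), Conf (Fin.snoc zi zl) →
      (∀ i, ‖zi i‖ < ‖zl‖) → (∀ i, 0 < ‖zi i‖) →
      AbsConvTo (fun k : ℤ =>
          B.gr.pair φ (B.gr.ext (fun x => B.YsR (v (Fin.last n)) x k) (Φ (Fin.init v) zi))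
            * zl ^ (-k - 1))
        (B.gr.pair φ (Ψ v (Fin.snoc zi zl)))

/-- Replace the two adjacent entries `i, i+1` of an `(n+1)`-tuple by a single entry. -/
def mergeAt {M : Type*} {n : ℕ} (i : Fin n) (v : Fin (n+1) → M) (a : M) : Fin n → M :=
  fun j => if j < i then v j.castSucc else if j = i then a else v j.succ

/-- `Ψ` represents `Φ ∘ᵢ E_V^{(2)}`, i.e. the map
`v ↦ E(Φ(v 1 ⊗ ⋯ ⊗ Y_V(v i, z i − ζ)Y_V(v (i+1), z (i+1) − ζ)𝟏 ⊗ ⋯ ⊗ v (n+1))(…,ζ,…))`. -/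
def RepCirc (A : MOSVA V) (B : Bimod A W) {n : ℕ} (i : Fin n)
    (Φ : (Fin n → V) → (Fin n → ℂ) → B.gr.Comp)
    (Ψ : (Fin (n+1) → V) → (Fin (n+1) → ℂ) → B.gr.Comp) : Prop :=
  (∀ v, B.gr.WTilde (Ψ v)) ∧
  ∀ (v : Fin (n+1) → V) (φ : W →ₗ[ℂ] ℂ), InGradedDual B.gr.proj φ →
    ∀ (z : Fin (n+1) → ℂ) (ζ : ℂ), Conf z → Conf (mergeAt i z ζ) →
      ‖z i.succ - ζ‖ < ‖z i.castSucc - ζ‖ → 0 < ‖z i.succ - ζ‖ →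
      (∀ j : Fin (n+1), j ≠ i.castSucc → j ≠ i.succ →
        ‖z i.castSucc - ζ‖ < ‖z j - z i.castSucc‖ ∧ ‖z i.succ - ζ‖ < ‖z j - z i.succ‖) →
      AbsConvTo (fun k : ℤ × ℤ =>
          B.gr.pair φ
            (Φ (mergeAt i v (A.Y (v i.castSucc) (A.Y (v i.succ) A.vac k.2) k.1))
              (mergeAt i z ζ))
            * (z i.castSucc - ζ) ^ (-k.1 - 1) * (z i.succ - ζ) ^ (-k.2 - 1))
        (B.gr.pair φ (Ψ v z))

/-- `Ψ` represents the coboundary `δ̂Φ = E_W^{(1,0)}∘₂Φ + Σᵢ (−1)^i Φ∘ᵢE_V^{(2)}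
+ (−1)^{n+1} E_W^{(0,1)}∘₂Φ` of the `n`-cochain `Φ`. -/
def IsDelta (A : MOSVA V) (B : Bimod A W) {n : ℕ}
    (Φ : (Fin n → V) → (Fin n → ℂ) → B.gr.Comp)
    (Ψ : (Fin (n+1) → V) → (Fin (n+1) → ℂ) → B.gr.Comp) : Prop :=
  ∃ (gL gR : (Fin (n+1) → V) → (Fin (n+1) → ℂ) → B.gr.Comp)
    (gC : Fin n → (Fin (n+1) → V) → (Fin (n+1) → ℂ) → B.gr.Comp),
    RepLeft A B Φ gL ∧ RepRight A B Φ gR ∧ (∀ i, RepCirc A B i Φ (gC i)) ∧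
    ∀ v z, Ψ v z = gL v z + (∑ i : Fin n, ((-1 : ℂ) ^ ((i : ℕ) + 1)) • gC i v z)
      + ((-1 : ℂ) ^ (n + 1)) • gR v z

end Cochains


section GradingLemmas

open Pointwise

variable {W : Type*} [AddCommGroup W] [Module ℂ W]

theorem CGrading.proj_proj (G : CGrading W) (m n : ℂ) (w : W) :
    G.proj m (G.proj n w) = if m = n then G.proj n w else 0 := by
  have h := congrArg (fun T : W →ₗ[ℂ] W => T w) (G.proj_comp m n)
  simp only [LinearMap.comp_apply] at h
  rw [h]
  split_ifs <;> simp

theorem ZGrading.proj_proj (G : ZGrading W) (m n : ℤ) (w : W) :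
    G.proj m (G.proj n w) = if m = n then G.proj n w else 0 := by
  have h := congrArg (fun T : W →ₗ[ℂ] W => T w) (G.proj_comp m n)
  simp only [LinearMap.comp_apply] at h
  rw [h]
  split_ifs <;> simp

theorem CGrading.d_proj (G : CGrading W) (n : ℂ) (w : W) :
    G.d (G.proj n w) = n • G.proj n w := by
  rw [CGrading.d, finsum_eq_single _ n, G.proj_proj, if_pos rfl]
  intro m hm
  rw [G.proj_proj, if_neg hm, smul_zero]

theorem ZGrading.d_proj (G : ZGrading W) (n : ℤ) (w : W) :
    G.d (G.proj n w) = (n : ℂ) • G.proj n w := by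
  rw [ZGrading.d, finsum_eq_single _ n, G.proj_proj, if_pos rfl]
  intro m hm
  rw [G.proj_proj, if_neg hm, smul_zero]

/-- An eigenvector of `d` has no components outside the weight given by its eigenvalue. -/
theorem CGrading.proj_eq_zero_of_d_eq (G : CGrading W) {w : W} {μ m : ℂ}
    (h : G.d w = μ • w) (hm : m ≠ μ) : G.proj m w = 0 := by
  have hfin : (Function.support fun n : ℂ => n • G.proj n w).Finite :=
    (G.proj_finite w).subset fun n hn => by
      simp only [Function.mem_support] at hn ⊢
      exact fun h0 => hn (by rw [h0, smul_zero])
  have h1 : G.proj m (G.d w) = m • G.proj m w := by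
    rw [CGrading.d, map_finsum _ hfin, finsum_eq_single _ m, map_smul, G.proj_proj, if_pos rfl]
    intro n hn
    rw [map_smul, G.proj_proj, if_neg (Ne.symm hn), smul_zero]
  rw [h, map_smul] at h1
  have h2 : (m - μ) • G.proj m w = 0 := by rw [sub_smul, h1, sub_self]
  exact (smul_eq_zero.mp h2).resolve_left (sub_ne_zero.mpr hm)

theorem ZGrading.exists_sum_proj (G : ZGrading W) (v : W) :
    ∃ P : Finset ℤ, v = ∑ p ∈ P, G.proj p v :=
  ⟨(G.proj_finite v).toFinset, by
    rw [← finsum_eq_sum_of_support_subset _ (s := (G.proj_finite v).toFinset) (by simp),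
      G.proj_sum]⟩

/-- A linear functional on `W` applied to the components of `w` in a set of weights
outside which the functional vanishes. -/
theorem CGrading.map_sum_proj (G : CGrading W) {M : Type*} [AddCommGroup M] [Module ℂ M]
    (T : W →ₗ[ℂ] M) (S : Finset ℂ) (hS : ∀ m ∉ S, ∀ w, T (G.proj m w) = 0) (w : W) :
    T (∑ m ∈ S, G.proj m w) = T w := by
  conv_rhs => rw [← G.proj_sum w, map_finsum _ (G.proj_finite w)]
  rw [map_sum, finsum_eq_sum_of_support_subset]
  intro m hm
  by_contra h
  exact hm (hS m h w)

/-- The operator `T` maps `W_[n]` into the sum of the `W_[m]` with `m - n ∈ Δ`. -/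
def CGrading.HasShift (G : CGrading W) (T : W →ₗ[ℂ] W) (Δ : Set ℂ) : Prop :=
  ∀ m n : ℂ, m - n ∉ Δ → ∀ w, G.proj m (T (G.proj n w)) = 0

theorem CGrading.HasShift.mono {G : CGrading W} {T : W →ₗ[ℂ] W} {Δ Δ' : Set ℂ}
    (h : G.HasShift T Δ) (hΔ : Δ ⊆ Δ') : G.HasShift T Δ' :=
  fun m n hmn w => h m n (fun h' => hmn (hΔ h')) w

theorem CGrading.HasShift.sum {G : CGrading W} {ι : Type*} {T : ι → W →ₗ[ℂ] W} {Δ : Set ℂ}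
    {s : Finset ι} (h : ∀ i ∈ s, G.HasShift (T i) Δ) : G.HasShift (∑ i ∈ s, T i) Δ := by
  intro m n hmn w
  rw [LinearMap.sum_apply, map_sum]
  exact Finset.sum_eq_zero fun i hi => h i hi m n hmn w

theorem CGrading.HasShift.comp {G : CGrading W} {T₁ T₂ : W →ₗ[ℂ] W} {Δ₁ Δ₂ : Set ℂ}
    (h₁ : G.HasShift T₁ Δ₁) (h₂ : G.HasShift T₂ Δ₂) : G.HasShift (T₁ ∘ₗ T₂) (Δ₁ + Δ₂) := by
  intro m n hmn w
  have key : ∀ l, G.proj m (T₁ (G.proj l (T₂ (G.proj n w)))) = 0 := by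
    intro l
    by_cases hl : l - n ∈ Δ₂
    · refine h₁ m l (fun hml => hmn ?_) _
      rw [← sub_add_sub_cancel m l n]
      exact Set.add_mem_add hml hl
    · rw [h₂ l n hl, map_zero, map_zero]
  have h := map_finsum (G.proj m ∘ₗ T₁) (G.proj_finite (T₂ (G.proj n w)))
  rw [G.proj_sum] at h
  exact h.trans (finsum_eq_zero_of_forall_eq_zero key)

theorem CGrading.ext_val (G : CGrading W) {T : W →ₗ[ℂ] W} {Δ : Set ℂ} (h : G.HasShift T Δ)
    (g : G.Comp) (m : ℂ) (S : Finset ℂ) (hS : ∀ n, m - n ∈ Δ → n ∈ S) :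
    (G.ext T g).1 m = G.proj m (T (∑ n ∈ S, g.1 n)) := by
  show ∑ᶠ n : ℂ, G.proj m (T (g.1 n)) = _
  rw [map_sum, map_sum]
  refine finsum_eq_sum_of_support_subset _ fun n hn => ?_
  by_contra hnS
  refine hn ?_
  show G.proj m (T (g.1 n)) = 0
  rw [← g.2 n]
  exact h m n (fun hmn => hnS (hS n hmn)) _

theorem CGrading.ext_ext (G : CGrading W) {T₁ T₂ : W →ₗ[ℂ] W} {Δ₁ Δ₂ : Set ℂ}
    (hf₁ : Δ₁.Finite) (hf₂ : Δ₂.Finite)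
    (h₁ : G.HasShift T₁ Δ₁) (h₂ : G.HasShift T₂ Δ₂) (g : G.Comp) :
    G.ext T₁ (G.ext T₂ g) = G.ext (T₁ ∘ₗ T₂) g := by
  refine Subtype.ext (funext fun l => ?_)
  have hfin₁ : ((fun a => l - a) '' Δ₁).Finite := hf₁.image _
  have hfin₂ : ((fun a => l - a) '' (Δ₁ + Δ₂)).Finite := (hf₁.add hf₂).image _
  rw [G.ext_val h₁ _ l hfin₁.toFinset (fun n hn => by simpa using ⟨_, hn, by ring⟩),
    G.ext_val (h₁.comp h₂) g l hfin₂.toFinset (fun n hn => by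
      rw [Set.Finite.mem_toFinset]; exact ⟨_, hn, by ring⟩)]
  set x : W := ∑ n ∈ hfin₂.toFinset, g.1 n
  have hsum : ∑ m ∈ hfin₁.toFinset, (G.ext T₂ g).1 m = ∑ m ∈ hfin₁.toFinset, G.proj m (T₂ x) := by
    refine Finset.sum_congr rfl fun m hm => G.ext_val h₂ g m _ fun n hn => ?_
    rw [Set.Finite.mem_toFinset] at hm ⊢
    obtain ⟨a, ha, rfl⟩ := hm
    exact ⟨a + (l - a - n), Set.add_mem_add ha hn, by ring⟩
  rw [hsum, LinearMap.comp_apply]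
  refine G.map_sum_proj (G.proj l ∘ₗ T₁) _ (fun m hm w => h₁ l m (fun h => hm ?_) w) _
  rw [Set.Finite.mem_toFinset]
  exact ⟨_, h, by ring⟩

theorem CGrading.pair_ext (G : CGrading W) {φ : W →ₗ[ℂ] ℂ} (hφ : InGradedDual G.proj φ)
    {T : W →ₗ[ℂ] W} {Δ : Set ℂ} (h : G.HasShift T Δ) (g : G.Comp) (S : Finset ℂ)
    (hS : ∀ m n, φ ∘ₗ G.proj m ≠ 0 → m - n ∈ Δ → n ∈ S) :
    G.pair φ (G.ext T g) = φ (T (∑ n ∈ S, g.1 n)) := by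
  have hφ' : (Function.support fun i => φ ∘ₗ G.proj i).Finite := hφ
  have hM : ∀ m ∉ hφ'.toFinset, ∀ w, φ (G.proj m w) = 0 := by
    intro m hm w
    rw [Set.Finite.mem_toFinset, Function.mem_support, not_not] at hm
    exact congrArg (fun T : W →ₗ[ℂ] ℂ => T w) hm
  rw [CGrading.pair, finsum_eq_sum_of_support_subset (s := hφ'.toFinset),
    ← G.map_sum_proj φ hφ'.toFinset hM, map_sum]
  · refine Finset.sum_congr rfl fun m hm => ?_
    rw [G.ext_val h g m S fun n hn => hS m n ?_ hn]
    simpa using hm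
  · intro m hm
    by_contra hm'
    refine hm ?_
    show φ ((G.ext T g).1 m) = 0
    rw [← (G.ext T g).2 m]
    exact hM m hm' _

end GradingLemmas

section VertexOperators

open Pointwise

variable {V : Type*} [AddCommGroup V] [Module ℂ V]
variable {W : Type*} [AddCommGroup W] [Module ℂ W] {A : MOSVA V}

/-- The coefficient operator `(Y_W^L)_k(v)` as a linear map in `v`. -/
def Bimod.opL (B : Bimod A W) (k : ℤ) : V →ₗ[ℂ] W →ₗ[ℂ] W where
  toFun v := LinearMap.proj k ∘ₗ B.YL v
  map_add' u v := by ext; simp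
  map_smul' c v := by ext; simp

theorem Bimod.hasShift_of_d_eq (B : Bimod A W) {u : V} {p : ℂ} (hu : A.gr.d u = p • u) (k : ℤ) :
    B.gr.HasShift (B.opL k u) {p - k - 1} := by
  intro m n hmn w
  refine B.gr.proj_eq_zero_of_d_eq (μ := p + n - k - 1) ?_ ?_
  · show B.gr.d (B.YL u (B.gr.proj n w) k) = _ • B.YL u (B.gr.proj n w) k
    rw [B.d_commL, hu, B.gr.d_proj]
    simp only [map_smul, LinearMap.smul_apply, Pi.smul_apply]
    module
  · rintro rfl
    exact hmn (by simp; ring)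

theorem MOSVA.d_Y_proj (A : MOSVA V) (p q : ℤ) (u v : V) (k : ℤ) :
    A.gr.d (A.Y (A.gr.proj p u) (A.gr.proj q v) k) =
      ((p : ℂ) + q - k - 1) • A.Y (A.gr.proj p u) (A.gr.proj q v) k := by
  rw [A.d_comm, A.gr.d_proj, A.gr.d_proj]
  simp only [map_smul, LinearMap.smul_apply, Pi.smul_apply]
  module

theorem Bimod.hasShift_opL (B : Bimod A W) (v : V) {P : Finset ℤ}
    (hP : v = ∑ p ∈ P, A.gr.proj p v) (k : ℤ) :
    B.gr.HasShift (B.opL k v) ((fun p : ℤ => (p : ℂ) - k - 1) '' P) := by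
  rw [hP, map_sum]
  refine CGrading.HasShift.sum fun p hp => ?_
  refine (B.hasShift_of_d_eq (A.gr.d_proj p v) k).mono ?_
  rw [Set.singleton_subset_iff]
  exact ⟨p, hp, rfl⟩

theorem Bimod.hasShift_opL_Y (B : Bimod A W) (u v : V) {P Q : Finset ℤ}
    (hP : u = ∑ p ∈ P, A.gr.proj p u) (hQ : v = ∑ q ∈ Q, A.gr.proj q v) (k l : ℤ) :
    B.gr.HasShift (B.opL k (A.Y u v l))
      (Set.image2 (fun p q : ℤ => (p : ℂ) + q - l - 1 - k - 1) P Q) := by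
  have hY : A.Y u v l = ∑ p ∈ P, ∑ q ∈ Q, A.Y (A.gr.proj p u) (A.gr.proj q v) l := by
    conv_lhs => rw [hP, hQ]
    simp only [map_sum, LinearMap.sum_apply, Finset.sum_apply]
    rw [Finset.sum_comm]
  rw [hY, map_sum]
  refine CGrading.HasShift.sum fun p hp => ?_
  rw [map_sum]
  refine CGrading.HasShift.sum fun q hq => ?_
  refine (B.hasShift_of_d_eq (A.d_Y_proj p q u v l) k).mono ?_
  rw [Set.singleton_subset_iff]
  exact ⟨p, hp, q, hq, rfl⟩

/-- In a fixed total degree, the coefficients of products and of iterates of two left vertex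
operators on an element of the completion are those on a single vector of `W`. -/
theorem Bimod.exists_vector (B : Bimod A W) (v₁ v₂ : V) (g : B.gr.Comp) {φ : W →ₗ[ℂ] ℂ}
    (hφ : InGradedDual B.gr.proj φ) (d : ℤ) :
    ∃ w : W, ∀ k l : ℤ, k + l = d →
      B.gr.pair φ (B.gr.ext (fun x => B.YL v₁ x k) (B.gr.ext (fun x => B.YL v₂ x l) g)) =
          φ (B.YL v₁ (B.YL v₂ w l) k) ∧
      B.gr.pair φ (B.gr.ext (fun x => B.YL (A.Y v₁ v₂ l) x k) g) =
          φ (B.YL (A.Y v₁ v₂ l) w k) := by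
  obtain ⟨P, hP⟩ := A.gr.exists_sum_proj v₁
  obtain ⟨Q, hQ⟩ := A.gr.exists_sum_proj v₂
  set Δ : Set ℂ := Set.image2 (fun p q : ℤ => (p : ℂ) + q - d - 2) P Q
  have hΔ : Δ.Finite := P.finite_toSet.image2 _ Q.finite_toSet
  have hS : (Set.image2 (fun m a : ℂ => m - a) {m | φ ∘ₗ B.gr.proj m ≠ 0} Δ).Finite :=
    hφ.image2 _ hΔ
  have hmem : ∀ m n, φ ∘ₗ B.gr.proj m ≠ 0 → m - n ∈ Δ → n ∈ hS.toFinset := by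
    intro m n hm hmn
    rw [Set.Finite.mem_toFinset]
    exact ⟨m, hm, m - n, hmn, by ring⟩
  refine ⟨∑ n ∈ hS.toFinset, g.1 n, fun k l hkl => ⟨?_, ?_⟩⟩
  · have h₁ := B.hasShift_opL v₁ hP k
    have h₂ := B.hasShift_opL v₂ hQ l
    have hcomp := (B.gr.ext_ext (P.finite_toSet.image _) (Q.finite_toSet.image _) h₁ h₂ g)
    refine (congrArg (B.gr.pair φ) hcomp).trans
      (B.gr.pair_ext hφ ((h₁.comp h₂).mono ?_) g hS.toFinset hmem)
    rintro _ ⟨_, ⟨p, hp, rfl⟩, _, ⟨q, hq, rfl⟩, rfl⟩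
    exact ⟨p, hp, q, hq, by rw [← hkl]; push_cast; ring⟩
  · refine B.gr.pair_ext hφ ((B.hasShift_opL_Y v₁ v₂ hP hQ k l).mono ?_) g hS.toFinset hmem
    rintro _ ⟨p, hp, q, hq, rfl⟩
    exact ⟨p, hp, q, hq, by rw [← hkl]; push_cast; ring⟩

end VertexOperators

section Series

theorem absConvTo_iff {ι : Type*} {f : ι → ℂ} {s : ℂ} : AbsConvTo f s ↔ HasSum f s :=
  ⟨fun h => h.2, fun h => ⟨h.summable.norm, h⟩⟩

/-- The `d`-th Fourier coefficient of the restriction of `F` to the unit circle. -/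
def circleCoeff (F : ℂ → ℂ) (d : ℤ) : ℂ :=
  (2 * Real.pi : ℂ)⁻¹ *
    ∫ θ in (0 : ℝ)..2 * Real.pi, F (Complex.exp (θ * Complex.I)) *
      Complex.exp (-(d * (θ * Complex.I)))

theorem integral_exp_int_mul (m : ℤ) :
    ∫ θ in (0 : ℝ)..2 * Real.pi, Complex.exp (m * (θ * Complex.I)) =
      if m = 0 then (2 * Real.pi : ℂ) else 0 := by
  split_ifs with hm
  · simp [hm]
  · have h := integral_exp_mul_complex (a := 0) (b := 2 * Real.pi) (c := m * Complex.I)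
      (by simp [hm])
    have h2 : Complex.exp (m * Complex.I * (2 * Real.pi : ℝ)) = 1 := by
      rw [← Complex.exp_int_mul_two_pi_mul_I m]
      congr 1
      push_cast
      ring
    rw [h2] at h
    simp only [Complex.ofReal_zero, mul_zero, Complex.exp_zero, sub_self, zero_div] at h
    rw [← h]
    refine intervalIntegral.integral_congr fun θ _ => ?_
    congr 1
    ring

/-- The part of weight `d` of a series which converges on the whole unit circle sums to a
Fourier coefficient of its sum. -/
theorem hasSum_circleCoeff {ι : Type*} [Countable ι] (deg : ι → ℤ) (u : ι → ℂ) (F : ℂ → ℂ)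
    (hF : ∀ c : ℂ, ‖c‖ = 1 → HasSum (fun i => u i * c ^ deg i) (F c)) (d : ℤ) :
    HasSum (fun i => if deg i = d then u i else 0) (circleCoeff F d) := by
  have hu : Summable fun i => ‖u i‖ := by
    have := (hF 1 (by simp)).summable.norm
    simpa using this
  have key : HasSum (fun i => ∫ θ in (0 : ℝ)..2 * Real.pi,
      u i * Complex.exp (((deg i - d : ℤ) : ℂ) * (θ * Complex.I)))
      (∫ θ in (0 : ℝ)..2 * Real.pi,
        F (Complex.exp (θ * Complex.I)) * Complex.exp (-(d * (θ * Complex.I)))) := by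
    refine intervalIntegral.hasSum_integral_of_dominated_convergence (fun i _ => ‖u i‖)
      ?_ ?_ ?_ ?_ ?_
    · intro i
      exact (Continuous.aestronglyMeasurable (by fun_prop))
    · intro i
      refine Filter.Eventually.of_forall fun θ _ => ?_
      have : ((deg i - d : ℤ) : ℂ) * (θ * Complex.I) =
          (((deg i - d : ℤ) * θ : ℝ) : ℂ) * Complex.I := by
        push_cast
        ring
      rw [norm_mul, this, Complex.norm_exp_ofReal_mul_I, mul_one]
    · exact Filter.Eventually.of_forall fun θ _ => hu
    · simp
    · refine Filter.Eventually.of_forall fun θ _ => ?_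
      have h := (hF (Complex.exp (θ * Complex.I)) (Complex.norm_exp_ofReal_mul_I θ)).mul_right
        (Complex.exp (-(d * (θ * Complex.I))))
      refine h.congr_fun fun i => ?_
      rw [mul_assoc, ← Complex.exp_int_mul, ← Complex.exp_add]
      congr 2
      push_cast
      ring
  have h2 := key.mul_left (2 * Real.pi : ℂ)⁻¹
  refine h2.congr_fun fun i => ?_
  rw [intervalIntegral.integral_const_mul, integral_exp_int_mul]
  have hpi : (Real.pi : ℂ) ≠ 0 := by exact_mod_cast Real.pi_ne_zero
  by_cases h : deg i = d
  · simp [h]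
    field_simp
  · simp [h, sub_eq_zero]

/-- A power series which vanishes at all small positive reals is zero. -/
theorem powerSeries_coeff_eq_zero {e : ℕ → ℂ} {ε : ℝ} (hε : 0 < ε)
    (h : ∀ t : ℝ, 0 < t → t < ε → HasSum (fun j => e j * (t : ℂ) ^ j) 0) (j : ℕ) : e j = 0 := by
  have hsum : ∀ z : ℂ, ‖z‖ < ε → Summable fun j => z ^ j * e j := by
    intro z hz
    obtain ⟨t, ht1, ht2⟩ := exists_between hz
    have ht0 : 0 < t := (norm_nonneg z).trans_lt ht1
    refine Summable.of_norm_bounded (h t ht0 ht2).summable.norm fun j => ?_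
    rw [norm_mul, norm_mul, mul_comm, norm_pow, norm_pow, Complex.norm_real,
      Real.norm_of_nonneg ht0.le]
    gcongr
  set F : ℂ → ℂ := fun z => ∑' j, z ^ j * e j
  have hp : HasFPowerSeriesAt F (FormalMultilinearSeries.ofScalars ℂ e) 0 := by
    rw [hasFPowerSeriesAt_iff, Metric.eventually_nhds_iff]
    refine ⟨ε, hε, fun {z} hz => ?_⟩
    rw [dist_zero_right] at hz
    simpa using (hsum z hz).hasSum
  have hfreq : ∃ᶠ z in nhdsWithin (0 : ℂ) {0}ᶜ, F z = 0 := by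
    rw [Filter.frequently_iff]
    intro U hU
    rw [mem_nhdsWithin] at hU
    obtain ⟨O, hO, h0, hOU⟩ := hU
    obtain ⟨δ, hδ, hball⟩ := Metric.isOpen_iff.mp hO 0 h0
    have hmin : 0 < min δ ε := lt_min hδ hε
    have hpos : 0 < min δ ε / 2 := half_pos hmin
    refine ⟨((min δ ε / 2 : ℝ) : ℂ), hOU ⟨hball ?_, ?_⟩, ?_⟩
    · rw [Metric.mem_ball, dist_zero_right, Complex.norm_real, Real.norm_of_nonneg hpos.le]
      exact (half_lt_self hmin).trans_le (min_le_left _ _)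
    · simpa using hpos.ne'
    · have := h _ hpos ((half_lt_self hmin).trans_le (min_le_right _ _))
      simpa [F, mul_comm] using this.tsum_eq
  have hev := (hp.analyticAt.frequently_zero_iff_eventually_zero).mp hfreq
  have hzero : FormalMultilinearSeries.ofScalars ℂ e = 0 := (hp.congr hev).eq_zero
  rw [← FormalMultilinearSeries.coeff_ofScalars (𝕜 := ℂ) (p := e) (n := j), hzero]
  rfl

/-- The negative binomial expansion in two variables. -/
theorem hasSum_choose_mul_pow {α β : ℂ} (h : ‖α‖ + ‖β‖ < 1) :
    HasSum (fun q : (Σ n : ℕ, Finset.HasAntidiagonal.antidiagonal n) =>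
      ((q.1.choose q.2.1.1 : ℕ) : ℂ) * (α ^ q.2.1.1 * β ^ q.2.1.2)) (1 - (α + β))⁻¹ := by
  have hfib : ∀ (R : Type) [CommSemiring R] (x y : R) (n : ℕ), ∑ q : Finset.HasAntidiagonal.antidiagonal n,
      ((n.choose q.1.1 : ℕ) : R) * (x ^ q.1.1 * y ^ q.1.2) = (x + y) ^ n := by
    intro R _ x y n
    rw [(Commute.all x y).add_pow', Finset.sum_coe_sort (Finset.HasAntidiagonal.antidiagonal n)
      fun q => ((n.choose q.1 : ℕ) : R) * (x ^ q.1 * y ^ q.2)]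
    simp only [nsmul_eq_mul]
  have hsum : HasSum (fun n : ℕ => (α + β) ^ n) (1 - (α + β))⁻¹ :=
    hasSum_geometric_of_norm_lt_one ((norm_add_le α β).trans_lt h)
  refine hsum.sigma_of_hasSum (fun n => ?_) ?_
  · rw [← hfib ℂ α β n]
    exact hasSum_fintype _
  · refine Summable.of_norm ?_
    rw [summable_sigma_of_nonneg fun _ => norm_nonneg _]
    refine ⟨fun n => (hasSum_fintype _).summable, ?_⟩
    have : Summable fun n : ℕ => (‖α‖ + ‖β‖) ^ n :=
      summable_geometric_of_lt_one (by positivity) h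
    refine this.congr fun n => ?_
    rw [tsum_fintype, ← hfib ℝ ‖α‖ ‖β‖ n]
    simp

end Series

section Expansions

/-- The Laurent monomial with exponent `k` in two variables. -/
def mono (k : ℤ × ℤ) (p : ℂ × ℂ) : ℂ := p.1 ^ k.1 * p.2 ^ k.2

/-- On `D`, the function `F` is the sum of a Laurent series in two variables with exponents in
`S`. -/
def Expands (S : Set (ℤ × ℤ)) (D : Set (ℂ × ℂ)) (F : ℂ × ℂ → ℂ) : Prop :=
  ∃ c : ℤ × ℤ → ℂ, (∀ k ∉ S, c k = 0) ∧ ∀ p ∈ D, HasSum (fun k => c k * mono k p) (F p)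

/-- A set of exponents closed under addition together with a domain on which the monomials with
these exponents are multiplicative. -/
structure Admissible (S : Set (ℤ × ℤ)) (D : Set (ℂ × ℂ)) : Prop where
  zero_mem : (0, 0) ∈ S
  add_mem : ∀ k ∈ S, ∀ l ∈ S, k + l ∈ S
  mono_add : ∀ k ∈ S, ∀ l ∈ S, ∀ p ∈ D, mono (k + l) p = mono k p * mono l p
  exists_ne : ∃ p ∈ D, p.1 ≠ 0 ∧ p.2 ≠ 0

variable {S : Set (ℤ × ℤ)} {D : Set (ℂ × ℂ)}

theorem Expands.congr {F G : ℂ × ℂ → ℂ} (hF : Expands S D F) (h : ∀ p ∈ D, G p = F p) :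
    Expands S D G := by
  obtain ⟨c, hc, hs⟩ := hF
  exact ⟨c, hc, fun p hp => by rw [h p hp]; exact hs p hp⟩

/-- A series of monomials over an arbitrary index type can be regrouped by exponents. -/
theorem Admissible.expands_of_hasSum (hD : Admissible S D) {ι : Type*} (deg : ι → ℤ × ℤ)
    (u : ι → ℂ) {F : ℂ × ℂ → ℂ} (hdeg : ∀ i, deg i ∉ S → u i = 0)
    (h : ∀ p ∈ D, HasSum (fun i => u i * mono (deg i) p) (F p)) : Expands S D F := by
  obtain ⟨p₀, hp₀, hne₁, hne₂⟩ := hD.exists_ne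
  have hmono : ∀ k, mono k p₀ ≠ 0 := fun k =>
    mul_ne_zero (zpow_ne_zero _ hne₁) (zpow_ne_zero _ hne₂)
  have hsum : ∀ k, Summable fun i : {i // deg i = k} => u i := by
    intro k
    have h1 : Summable fun i : {i // deg i = k} => u i * mono (deg i) p₀ :=
      (h p₀ hp₀).summable.comp_injective Subtype.val_injective
    refine (h1.mul_right (mono k p₀)⁻¹).congr fun i => ?_
    rw [i.2, mul_assoc, mul_inv_cancel₀ (hmono k), mul_one]
  refine ⟨fun k => ∑' i : {i // deg i = k}, u i, fun k hk => ?_, fun p hp => ?_⟩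
  · have : ∀ i : {i // deg i = k}, u i = 0 := fun i => hdeg i (by rw [i.2]; exact hk)
    simp [this]
  · have h1 := (Equiv.sigmaFiberEquiv deg).hasSum_iff.mpr (h p hp)
    refine h1.sigma fun k => ?_
    refine ((hsum k).hasSum.mul_right (mono k p)).congr_fun fun i => ?_
    show u i * mono (deg i) p = _
    rw [i.2]

theorem Expands.add {F G : ℂ × ℂ → ℂ} (hF : Expands S D F) (hG : Expands S D G) :
    Expands S D fun p => F p + G p := by
  obtain ⟨c, hc, hs⟩ := hF
  obtain ⟨c', hc', hs'⟩ := hG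
  refine ⟨fun k => c k + c' k, fun k hk => by simp [hc k hk, hc' k hk], fun p hp => ?_⟩
  simpa only [add_mul] using (hs p hp).add (hs' p hp)

theorem Expands.const_mul {F : ℂ × ℂ → ℂ} (a : ℂ) (hF : Expands S D F) :
    Expands S D fun p => a * F p := by
  obtain ⟨c, hc, hs⟩ := hF
  refine ⟨fun k => a * c k, fun k hk => by simp [hc k hk], fun p hp => ?_⟩
  simpa only [mul_assoc] using (hs p hp).mul_left a

theorem Admissible.expands_mul (hD : Admissible S D) {F G : ℂ × ℂ → ℂ} (hF : Expands S D F)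
    (hG : Expands S D G) : Expands S D fun p => F p * G p := by
  obtain ⟨c, hc, hs⟩ := hF
  obtain ⟨c', hc', hs'⟩ := hG
  refine hD.expands_of_hasSum (fun q : (ℤ × ℤ) × (ℤ × ℤ) => q.1 + q.2)
    (fun q => c q.1 * c' q.2) (fun q hq => ?_) (fun p hp => ?_)
  · by_cases h1 : q.1 ∈ S
    · rw [hc' q.2 fun h2 => hq (hD.add_mem _ h1 _ h2), mul_zero]
    · rw [hc _ h1, zero_mul]
  · have h := HasSum.mul (f := fun k => c k * mono k p)
      (g := fun k => c' k * mono k p) (hs p hp) (hs' p hp)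
      (summable_mul_of_summable_norm (f := fun k => c k * mono k p)
        (g := fun k => c' k * mono k p) (hs p hp).summable.norm (hs' p hp).summable.norm)
    refine h.congr_fun fun q => ?_
    by_cases h1 : q.1 ∈ S
    · by_cases h2 : q.2 ∈ S
      · rw [hD.mono_add _ h1 _ h2 p hp]
        ring
      · simp [hc' _ h2]
    · simp [hc _ h1]

theorem Admissible.expands_mono (hD : Admissible S D) {k : ℤ × ℤ} (hk : k ∈ S) :
    Expands S D (mono k) :=
  hD.expands_of_hasSum (fun _ : Unit => k) (fun _ => 1) (fun _ h => absurd hk h)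
    fun p _ => by simp [hasSum_unique]

theorem Admissible.expands_const (hD : Admissible S D) (a : ℂ) : Expands S D fun _ => a :=
  ((hD.expands_mono hD.zero_mem).const_mul a).congr fun p _ => by simp [mono]

theorem Admissible.expands_pow (hD : Admissible S D) {F : ℂ × ℂ → ℂ} (hF : Expands S D F)
    (m : ℕ) : Expands S D fun p => F p ^ m := by
  induction m with
  | zero => simp only [pow_zero]; exact hD.expands_const 1
  | succ m ih => simpa only [pow_succ] using hD.expands_mul ih hF

theorem Admissible.expands_prod (hD : Admissible S D) {κ : Type*} (s : Finset κ)
    {F : κ → ℂ × ℂ → ℂ} (hF : ∀ i ∈ s, Expands S D (F i)) :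
    Expands S D fun p => ∏ i ∈ s, F i p := by
  classical
  induction s using Finset.induction_on with
  | empty => simpa using hD.expands_const 1
  | insert i s his ih =>
    simp only [Finset.prod_insert his]
    exact hD.expands_mul (hF i (Finset.mem_insert_self i s))
      (ih fun j hj => hF j (Finset.mem_insert_of_mem hj))

theorem Admissible.expands_mvPolynomial (hD : Admissible S D) {σ : Type*}
    (P : MvPolynomial σ ℂ) {z : ℂ × ℂ → σ → ℂ} (hz : ∀ i, Expands S D fun p => z p i) :
    Expands S D fun p => MvPolynomial.eval (z p) P := by
  induction P using MvPolynomial.induction_on with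
  | C a => simpa using hD.expands_const a
  | add P Q hP hQ => simpa using hP.add hQ
  | mul_X P i hP => simpa using hD.expands_mul hP (hz i)

end Expansions

section IterateDomain

variable {n : ℕ}

/-- The exponents allowed in expansions on `iterDomain zt`; without points `zt` the second
variable may vanish, which forbids negative powers of it. -/
def iterExps (n : ℕ) : Set (ℤ × ℤ) := {k | 0 ≤ k.1 ∧ (n = 0 → 0 ≤ k.2)}

/-- The domain of convergence of iterates, in the variables `z₁ - z₂` and `z₂`. -/
def iterDomain (zt : Fin n → ℂ) : Set (ℂ × ℂ) :=
  {p | p.1 ≠ 0 ∧ ∀ i, ‖p.1‖ + ‖zt i‖ < ‖p.2‖}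

/-- The configuration `(z₁, z₂, zt)` in terms of `z₁ - z₂` and `z₂`. -/
def iterConf (zt : Fin n → ℂ) (p : ℂ × ℂ) : Fin (n + 2) → ℂ :=
  Fin.cons (p.1 + p.2) (Fin.cons p.2 zt)

theorem admissible_iterDomain (zt : Fin n → ℂ) : Admissible (iterExps n) (iterDomain zt) where
  zero_mem := ⟨le_rfl, fun _ => le_rfl⟩
  add_mem := fun k hk l hl =>
    ⟨add_nonneg hk.1 hl.1, fun h => add_nonneg (hk.2 h) (hl.2 h)⟩
  mono_add := by
    intro k hk l hl p hp
    have h2 : p.2 ^ (k.2 + l.2) = p.2 ^ k.2 * p.2 ^ l.2 := by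
      rcases n with - | n
      · rw [← Int.toNat_of_nonneg (hk.2 rfl), ← Int.toNat_of_nonneg (hl.2 rfl), ← Nat.cast_add,
          zpow_natCast, zpow_natCast, zpow_natCast, pow_add]
      · refine zpow_add₀ ?_ _ _
        have := hp.2 0
        exact norm_pos_iff.mp (lt_of_le_of_lt (by positivity) this)
    simp only [mono, Prod.fst_add, Prod.snd_add, zpow_add₀ hp.1, h2]
    ring
  exists_ne := by
    have hs : (0 : ℝ) ≤ ∑ i, ‖zt i‖ := by positivity
    refine ⟨(1, ((∑ i, ‖zt i‖ + 2 : ℝ) : ℂ)), ⟨one_ne_zero, fun i => ?_⟩, one_ne_zero, ?_⟩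
    · have := Finset.single_le_sum (fun j _ => norm_nonneg (zt j)) (Finset.mem_univ i)
      rw [Complex.norm_real, Real.norm_of_nonneg (by positivity)]
      simp only [norm_one]
      linarith
    · simp only [ne_eq, Complex.ofReal_eq_zero]
      positivity

theorem snd_ne_zero_of_mem_iterDomain {zt : Fin n → ℂ} {p : ℂ × ℂ} (hp : p ∈ iterDomain zt)
    (i : Fin n) : p.2 ≠ 0 :=
  norm_pos_iff.mp ((by positivity : 0 ≤ ‖p.1‖ + ‖zt i‖).trans_lt (hp.2 i))

theorem expands_fst (zt : Fin n → ℂ) : Expands (iterExps n) (iterDomain zt) fun p => p.1 :=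
  ((admissible_iterDomain zt).expands_mono (k := (1, 0)) ⟨zero_le_one, fun _ => le_rfl⟩).congr
    fun p _ => by simp [mono]

theorem expands_snd (zt : Fin n → ℂ) : Expands (iterExps n) (iterDomain zt) fun p => p.2 :=
  ((admissible_iterDomain zt).expands_mono (k := (0, 1)) ⟨le_rfl, fun _ => zero_le_one⟩).congr
    fun p _ => by simp [mono]

theorem expands_inv_snd_sub (zt : Fin n → ℂ) (i : Fin n) :
    Expands (iterExps n) (iterDomain zt) fun p => (p.2 - zt i)⁻¹ := by
  refine (admissible_iterDomain zt).expands_of_hasSum (fun j : ℕ => (0, -1 - (j : ℤ)))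
    (fun j => zt i ^ j) (fun j hj => absurd ⟨le_rfl, fun h => ?_⟩ hj) (fun p hp => ?_)
  swap
  · subst h
    exact i.elim0
  · have hp2 := snd_ne_zero_of_mem_iterDomain hp i
    have hlt : ‖zt i / p.2‖ < 1 := by
      rw [norm_div, div_lt_one (norm_pos_iff.mpr hp2)]
      linarith [hp.2 i, norm_nonneg p.1]
    have h := (hasSum_geometric_of_norm_lt_one hlt).mul_left p.2⁻¹
    rw [← mul_inv, mul_sub, mul_one, mul_div_cancel₀ _ hp2] at h
    refine h.congr_fun fun j => ?_
    simp only [mono, zpow_zero, one_mul, zpow_sub₀ hp2, zpow_neg, zpow_one, zpow_natCast, div_pow]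
    field_simp

theorem expands_inv_fst_add_snd_sub (zt : Fin n → ℂ) (i : Fin n) :
    Expands (iterExps n) (iterDomain zt) fun p => (p.1 + p.2 - zt i)⁻¹ := by
  refine (admissible_iterDomain zt).expands_of_hasSum
    (fun q : (Σ n : ℕ, Finset.HasAntidiagonal.antidiagonal n) =>
      ((q.2.1.1 : ℤ), -1 - (q.2.1.1 : ℤ) - (q.2.1.2 : ℤ)))
    (fun q => ((q.1.choose q.2.1.1 : ℕ) : ℂ) * ((-1) ^ q.2.1.1 * zt i ^ q.2.1.2))
    (fun j hj => absurd ⟨by positivity, fun h => ?_⟩ hj) (fun p hp => ?_)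
  swap
  · subst h
    exact i.elim0
  · have hp2 := snd_ne_zero_of_mem_iterDomain hp i
    have hlt : ‖-p.1 / p.2‖ + ‖zt i / p.2‖ < 1 := by
      rw [norm_div, norm_div, norm_neg, ← add_div, div_lt_one (norm_pos_iff.mpr hp2)]
      exact hp.2 i
    have h := (hasSum_choose_mul_pow hlt).mul_left p.2⁻¹
    have he : p.2 * (1 - (-p.1 / p.2 + zt i / p.2)) = p.1 + p.2 - zt i := by
      field_simp
      ring
    rw [← mul_inv, he] at h
    refine h.congr_fun fun q => ?_
    simp only [mono, zpow_sub₀ hp2, zpow_neg, zpow_one, zpow_natCast, div_pow, neg_pow p.1]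
    field_simp

theorem expands_iterConf (zt : Fin n → ℂ) (i : Fin (n + 2)) :
    Expands (iterExps n) (iterDomain zt) fun p => iterConf zt p i := by
  refine Fin.cases ?_ (fun i => Fin.cases ?_ (fun i => ?_) i) i
  · exact (expands_fst zt).add (expands_snd zt)
  · exact expands_snd zt
  · exact (admissible_iterDomain zt).expands_const (zt i)

theorem expands_fst_mul_inv_sub (zt : Fin n → ℂ) {i j : Fin (n + 2)} (hij : i ≠ j) :
    Expands (iterExps n) (iterDomain zt)
      fun p => p.1 * (iterConf zt p i - iterConf zt p j)⁻¹ := by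
  have hD := admissible_iterDomain zt
  wlog hlt : i < j generalizing i j
  · refine ((this hij.symm (hij.lt_or_gt.resolve_left hlt)).const_mul (-1)).congr fun p _ => ?_
    rw [← neg_sub, inv_neg]
    ring
  revert hlt
  refine Fin.cases (fun hlt => ?_) (fun i => ?_) i
  · obtain ⟨j, rfl⟩ := Fin.exists_succ_eq_of_ne_zero hlt.ne'
    refine Fin.cases ?_ (fun j => ?_) j
    · refine (hD.expands_const 1).congr fun p hp => ?_
      have : iterConf zt p 0 - iterConf zt p (Fin.succ 0) = p.1 := add_sub_cancel_right _ _
      rw [this, mul_inv_cancel₀ hp.1]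
    · exact hD.expands_mul (expands_fst zt) (expands_inv_fst_add_snd_sub zt j)
  · intro hlt
    obtain ⟨j, rfl⟩ := Fin.exists_succ_eq_of_ne_zero ((Fin.zero_le _).trans_lt hlt).ne'
    rw [Fin.succ_lt_succ_iff] at hlt
    obtain ⟨j, rfl⟩ := Fin.exists_succ_eq_of_ne_zero ((Fin.zero_le _).trans_lt hlt).ne'
    revert hlt
    refine Fin.cases (fun _ => ?_) (fun i _ => ?_) i
    · exact hD.expands_mul (expands_fst zt) (expands_inv_snd_sub zt j)
    · exact hD.expands_mul (expands_fst zt) (hD.expands_const (zt i - zt j)⁻¹)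

theorem expands_pow_mul_eval (zt : Fin n → ℂ) (R : DiagRatFn (Fin (n + 2))) (N : ℕ) :
    Expands (iterExps n) (iterDomain zt) fun p =>
      p.1 ^ (N + ∑ q ∈ Finset.univ.offDiag, R.b q.1 q.2) * R.eval (iterConf zt p) := by
  have hD := admissible_iterDomain zt
  have hprod := hD.expands_prod Finset.univ.offDiag fun q hq =>
    hD.expands_pow (expands_fst_mul_inv_sub zt (Finset.mem_offDiag.mp hq).2.2) (R.b q.1 q.2)
  refine (hD.expands_mul (hD.expands_pow (expands_fst zt) N) (hD.expands_mul
    (hD.expands_mvPolynomial R.num (expands_iterConf zt)) hprod)).congr fun p _ => ?_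
  simp only [DiagRatFn.eval, mul_pow, Finset.prod_mul_distrib, Finset.prod_pow_eq_pow_sum,
    inv_pow, Finset.prod_inv_distrib, pow_add]
  ring

end IterateDomain

section Comparison

/-- The homogeneous parts of a doubly infinite series which converges on a circle. -/
theorem hasSum_homogeneous {u : ℤ × ℤ → ℂ} {F : ℂ → ℂ} {y₁ y₂ : ℂ}
    (h : ∀ c : ℂ, ‖c‖ = 1 →
      HasSum (fun k => u k * (c * y₁) ^ (-k.1 - 1) * (c * y₂) ^ (-k.2 - 1)) (F c)) (s : ℤ) :
    HasSum (fun k => if k.1 + k.2 = s then u k * y₁ ^ (-k.1 - 1) * y₂ ^ (-k.2 - 1) else 0)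
      (circleCoeff F (-2 - s)) := by
  have h' := hasSum_circleCoeff (fun k : ℤ × ℤ => (-k.1 - 1) + (-k.2 - 1))
    (fun k => u k * y₁ ^ (-k.1 - 1) * y₂ ^ (-k.2 - 1)) F (fun c hc => ?_) (-2 - s)
  · refine h'.congr_fun fun k => ?_
    have : (-k.1 - 1) + (-k.2 - 1) = -2 - s ↔ k.1 + k.2 = s := by omega
    simp only [this]
  · have hc0 : c ≠ 0 := norm_ne_zero_iff.mp (by rw [hc]; exact one_ne_zero)
    refine (h c hc).congr_fun fun k => ?_
    rw [mul_zpow, mul_zpow, zpow_add₀ hc0]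
    ring

/-- Two series of iterate type whose homogeneous parts have the same sums have the same
coefficients. -/
theorem coeff_eq_of_homogeneous {u v : ℤ × ℤ → ℂ} {M : ℤ} (hu : ∀ k, M ≤ k.2 → u k = 0)
    (hv : ∀ k, M ≤ k.2 → v k = 0) {r ε : ℝ} (hr : 0 < r) (hε : 0 < ε)
    (h : ∀ t : ℝ, 0 < t → t < ε → ∀ s : ℤ, ∃ a : ℂ,
      HasSum (fun k : ℤ × ℤ => if k.1 + k.2 = s then
        u k * (r : ℂ) ^ (-k.1 - 1) * ((r : ℂ) * t) ^ (-k.2 - 1) else 0) a ∧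
      HasSum (fun k : ℤ × ℤ => if k.1 + k.2 = s then
        v k * (r : ℂ) ^ (-k.1 - 1) * ((r : ℂ) * t) ^ (-k.2 - 1) else 0) a) : u = v := by
  funext k
  rcases le_or_gt M k.2 with hk | hk
  · rw [hu k hk, hv k hk]
  have hr0 : (r : ℂ) ≠ 0 := by exact_mod_cast hr.ne'
  let g : ℕ → ℤ × ℤ := fun j => (k.1 + k.2 - (M - 1 - j), M - 1 - j)
  have hg : Function.Injective g := fun i j hij => by
    have := congrArg Prod.snd hij
    simp only [g] at this
    omega
  have hzero : ∀ j, u (g j) - v (g j) = 0 := by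
    refine powerSeries_coeff_eq_zero hε fun t ht ht' => ?_
    have ht0 : (t : ℂ) ≠ 0 := by exact_mod_cast ht.ne'
    obtain ⟨a, h₁, h₂⟩ := h t ht ht' (k.1 + k.2)
    have h₃ := h₁.sub h₂
    rw [sub_self, ← hg.hasSum_iff] at h₃
    · have h₄ := h₃.mul_left ((r : ℂ) ^ (k.1 + k.2 + 2) * (t : ℂ) ^ M)
      rw [mul_zero] at h₄
      refine h₄.congr_fun fun j => ?_
      simp only [Function.comp, g, sub_add_cancel, if_true]
      rw [mul_zpow]
      have h1 : (r : ℂ) ^ (k.1 + k.2 + 2) * ((r : ℂ) ^ (-(k.1 + k.2 - (M - 1 - j)) - 1) *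
          (r : ℂ) ^ (-(M - 1 - j) - 1 : ℤ)) = 1 := by
        rw [← zpow_add₀ hr0, ← zpow_add₀ hr0, ← zpow_zero (r : ℂ)]
        congr 1
        ring
      have h2 : (t : ℂ) ^ M * (t : ℂ) ^ (-(M - 1 - j) - 1 : ℤ) = (t : ℂ) ^ j := by
        rw [← zpow_add₀ ht0, ← zpow_natCast]
        congr 1
        ring
      rw [← h2]
      linear_combination ((v (g j) - u (g j)) * ((t : ℂ) ^ M * (t : ℂ) ^ (-(M - 1 - j) - 1 : ℤ))) * h1
    · intro q hq
      by_cases hqs : q.1 + q.2 = k.1 + k.2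
      · have hq2 : M ≤ q.2 := by
          by_contra hlt
          refine hq ⟨(M - 1 - q.2).toNat, ?_⟩
          refine Prod.ext ?_ ?_ <;> simp only [g] <;> omega
        simp [hu q hq2, hv q hq2]
      · simp [hqs]
  have hk' : g (M - 1 - k.2).toNat = k := by
    refine Prod.ext ?_ ?_ <;> simp only [g] <;> omega
  rw [← hk']
  exact sub_eq_zero.mp (hzero _)

end Comparison

section Iterates

variable {n : ℕ}

theorem conf_cons {n : ℕ} {z : ℂ} {zt : Fin n → ℂ} :
    Conf (Fin.cons z zt : Fin (n + 1) → ℂ) ↔ (∀ i, z ≠ zt i) ∧ Conf zt := by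
  refine ⟨fun h => ⟨fun i => by simpa using h 0 i.succ (Fin.succ_ne_zero i).symm,
    fun i j hij => by simpa using h i.succ j.succ (by simpa using hij)⟩, fun h i j => ?_⟩
  refine Fin.cases (Fin.cases (fun hij => absurd rfl hij) (fun j _ => ?_) j)
    (fun i => Fin.cases (fun _ => ?_) (fun j hij => ?_) j) i
  · simpa using h.1 j
  · simpa using (h.1 i).symm
  · simpa using h.2 i j (by simpa using hij)

theorem conf_cons_cons_of_norm_lt {z₁ z₂ : ℂ} {zt : Fin n → ℂ} (hzt : Conf zt)
    (h₁ : ‖z₂‖ < ‖z₁‖) (h₂ : ∀ i, ‖zt i‖ < ‖z₂‖) :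
    Conf (Fin.cons z₁ (Fin.cons z₂ zt) : Fin (n + 2) → ℂ) := by
  refine conf_cons.mpr ⟨fun i => ?_, conf_cons.mpr
    ⟨fun i h => (h₂ i).ne (congrArg norm h).symm, hzt⟩⟩
  refine Fin.cases ?_ (fun i => ?_) i
  · exact fun h => h₁.ne (congrArg norm h).symm
  · exact fun h => ((h₂ i).trans h₁).ne (congrArg norm h).symm

variable {V : Type*} [AddCommGroup V] [Module ℂ V]
variable {W : Type*} [AddCommGroup W] [Module ℂ W] {A : MOSVA V}

/-- In a fixed total degree, the product series and the iterate series of left vertex operators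
on an element of the completion have the same sum. -/
theorem Bimod.hasSum_iterate_of_product (B : Bimod A W) (v₁ v₂ : V) (g : B.gr.Comp)
    {φ : W →ₗ[ℂ] ℂ} (hφ : InGradedDual B.gr.proj φ) {z₁ z₂ : ℂ} (h₁ : ‖z₂‖ < ‖z₁‖)
    (h₁₂ : ‖z₁ - z₂‖ < ‖z₂‖) (hz : z₁ ≠ z₂) (s : ℤ) {a : ℂ}
    (ha : HasSum (fun k : ℤ × ℤ => if k.1 + k.2 = s then
      B.gr.pair φ (B.gr.ext (fun x => B.YL v₁ x k.1) (B.gr.ext (fun x => B.YL v₂ x k.2) g))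
        * z₁ ^ (-k.1 - 1) * z₂ ^ (-k.2 - 1) else 0) a) :
    HasSum (fun k : ℤ × ℤ => if k.1 + k.2 = s then
      B.gr.pair φ (B.gr.ext (fun x => B.YL (A.Y v₁ v₂ k.2) x k.1) g)
        * z₂ ^ (-k.1 - 1) * (z₁ - z₂) ^ (-k.2 - 1) else 0) a := by
  obtain ⟨w, hw⟩ := B.exists_vector v₁ v₂ g hφ s
  obtain ⟨R, hR₁, hR₂⟩ := B.associativityL v₁ v₂ w φ hφ
  have hz₂ : 0 < ‖z₂‖ := (norm_nonneg _).trans_lt h₁₂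
  have hprod := hasSum_homogeneous (F := fun c => R.eval ![c * z₁, c * z₂]) (fun c hc =>
    (hR₁ (c * z₁) (c * z₂) (by simpa [hc] using h₁) (by simpa [hc] using hz₂)).2) s
  have hiter := hasSum_homogeneous (u := fun k => φ (B.YL (A.Y v₁ v₂ k.2) w k.1))
    (y₁ := z₂) (y₂ := z₁ - z₂) (F := fun c => R.eval ![c * z₁, c * z₂]) (fun c hc => ?_) s
  · have hae : a = circleCoeff (fun c => R.eval ![c * z₁, c * z₂]) (-2 - s) := by
      refine ha.unique (hprod.congr_fun fun k => ?_)
      split_ifs with hk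
      · rw [(hw _ _ hk).1]
      · rfl
    rw [hae]
    refine hiter.congr_fun fun k => ?_
    split_ifs with hk
    · rw [(hw _ _ hk).2]
    · rfl
  · have h := (hR₂ (c * z₁) (c * z₂) (by simpa [hc, ← mul_sub] using h₁₂)
      (by simpa [hc, ← mul_sub, sub_eq_zero] using hz)).2
    rw [← (Equiv.prodComm ℤ ℤ).hasSum_iff] at h
    refine h.congr_fun fun k => ?_
    simp only [Function.comp, Equiv.prodComm_apply, Prod.fst_swap, Prod.snd_swap, mul_sub]
    ring

end Iterates

section Iterates

variable {n : ℕ}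

/-- A rational function with poles on the diagonals is the sum of a series of iterate type with
poles of bounded order in the first variable. -/
theorem exists_iterate_expansion (zt : Fin n → ℂ) (R : DiagRatFn (Fin (n + 2))) (N : ℤ) :
    ∃ (M : ℤ) (u : ℤ × ℤ → ℂ), N ≤ M ∧ (∀ k, M ≤ k.2 → u k = 0) ∧ ∀ p ∈ iterDomain zt,
      HasSum (fun k => u k * p.2 ^ (-k.1 - 1) * p.1 ^ (-k.2 - 1)) (R.eval (iterConf zt p)) := by
  obtain ⟨c, hc₀, hc⟩ := expands_pow_mul_eval zt R N.toNat
  set m : ℕ := N.toNat + ∑ q ∈ Finset.univ.offDiag, R.b q.1 q.2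
  refine ⟨m, fun k => c (m - 1 - k.2, -1 - k.1), ?_, fun k hk => hc₀ _ fun h => ?_,
    fun p hp => ?_⟩
  · exact (Int.self_le_toNat N).trans (by exact_mod_cast Nat.le_add_right _ _)
  · have := h.1
    simp only at this
    omega
  · let e : ℤ × ℤ ≃ ℤ × ℤ :=
      { toFun := fun k => (m - 1 - k.2, -1 - k.1)
        invFun := fun k => (-1 - k.2, m - 1 - k.1)
        left_inv := fun k => by ext <;> simp
        right_inv := fun k => by ext <;> simp }
    have h := (hc p hp).mul_left (p.1 ^ m)⁻¹
    rw [inv_mul_cancel_left₀ (pow_ne_zero _ hp.1), ← e.hasSum_iff] at h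
    refine h.congr_fun fun k => ?_
    have h₁ : p.1 ^ (-k.2 - 1) = (p.1 ^ m)⁻¹ * p.1 ^ ((m : ℤ) - 1 - k.2) := by
      rw [← zpow_natCast, ← zpow_neg, ← zpow_add₀ hp.1]
      congr 1
      ring
    have h₂ : -k.1 - 1 = -1 - k.1 := by ring
    simp only [Function.comp, e, Equiv.coe_fn_mk, mono, h₁, h₂]
    ring

end Iterates

/-- Let `V` be a MOSVA and `W` a `V`-bimodule, both satisfying the
pole-order condition. Let `v₁, v₂ ∈ V` and `f ∈ W̃_{z₃,…,z_{n+2}}` be such that the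
series `Y_W^L(v₁,z₁)Y_W^L(v₂,z₂)f(z₃,…,z_{n+2})` converges absolutely (to the
`W̄`-valued rational function `h`) whenever `|z₁| > |z₂| > |z_i|`. Then for every
point with `|z₂| > |z₁ − z₂| + |z_i|` (`i = 3,…,n+2`), the series
`Y_W^L(Y_V(v₁,z₁−z₂)v₂,z₂)f(z₃,…,z_{n+2})` also converges absolutely to the same
`W̄`-valued rational function. -/
theorem statement9 {V : Type*} [AddCommGroup V] [Module ℂ V]
    {W : Type*} [AddCommGroup W] [Module ℂ W]
    (A : MOSVA V) (B : Bimod A W) (hA : A.PoleOrder) (hB : B.PoleOrder)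
    (n : ℕ) (v₁ v₂ : V)
    (f : (Fin n → ℂ) → B.gr.Comp) (hfW : B.gr.WTilde f)
    (h : (Fin (n+2) → ℂ) → B.gr.Comp) (hhW : B.gr.WTilde h)
    (hconv : ∀ (z₁ z₂ : ℂ) (zt : Fin n → ℂ), Conf (Fin.cons z₁ (Fin.cons z₂ zt)) →
      ‖z₂‖ < ‖z₁‖ → (∀ i, ‖zt i‖ < ‖z₂‖) →
      ∀ φ : W →ₗ[ℂ] ℂ, InGradedDual B.gr.proj φ →
        AbsConvTo (fun k : ℤ × ℤ =>
            B.gr.pair φ (B.gr.ext (fun x => B.YL v₁ x k.1)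
                (B.gr.ext (fun x => B.YL v₂ x k.2) (f zt)))
              * z₁ ^ (-k.1 - 1) * z₂ ^ (-k.2 - 1))
          (B.gr.pair φ (h (Fin.cons z₁ (Fin.cons z₂ zt))))) :
    ∀ (z₁ z₂ : ℂ) (zt : Fin n → ℂ), Conf (Fin.cons z₁ (Fin.cons z₂ zt)) →
      (∀ i, ‖z₁ - z₂‖ + ‖zt i‖ < ‖z₂‖) →
      ∀ φ : W →ₗ[ℂ] ℂ, InGradedDual B.gr.proj φ →
        AbsConvTo (fun k : ℤ × ℤ =>
            B.gr.pair φ (B.gr.ext (fun x => B.YL (A.Y v₁ v₂ k.2) x k.1) (f zt))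
              * (z₁ - z₂) ^ (-k.2 - 1) * z₂ ^ (-k.1 - 1))
          (B.gr.pair φ (h (Fin.cons z₁ (Fin.cons z₂ zt)))) := by
  intro z₁ z₂ zt hconf hz φ hφ
  have hz₁₂ : z₁ ≠ z₂ := (conf_cons.mp hconf).1 0
  have hzt : Conf zt := (conf_cons.mp (conf_cons.mp hconf).2).2
  obtain ⟨R, hR⟩ := hhW.1 φ hφ
  obtain ⟨N, hN⟩ := A.trunc v₁ v₂
  obtain ⟨M, u, hNM, hu, hexp⟩ := exists_iterate_expansion zt R N
  have hJ : u = fun k => B.gr.pair φ (B.gr.ext (fun x => B.YL (A.Y v₁ v₂ k.2) x k.1) (f zt)) := by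
    have hsum : 0 ≤ ∑ i, ‖zt i‖ := Finset.sum_nonneg fun i _ => norm_nonneg _
    have hle : ∀ i, ‖zt i‖ ≤ ∑ i, ‖zt i‖ := fun i =>
      Finset.single_le_sum (fun j _ => norm_nonneg (zt j)) (Finset.mem_univ i)
    set r : ℝ := 2 * (∑ i, ‖zt i‖ + 1) with hr
    have hr0 : 0 < r := by positivity
    refine coeff_eq_of_homogeneous hu (fun k hk => ?_) hr0 one_half_pos fun t ht ht' s =>
      ⟨_, hasSum_homogeneous (F := fun c => R.eval (iterConf zt (c * (r * t), c * r)))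
        (fun c hc => hexp (c * (r * t), c * r) ?_) s, ?_⟩
    · simp [hN k.2 (hNM.trans hk), CGrading.pair, CGrading.ext]
    · have hc0 : c ≠ 0 := norm_ne_zero_iff.mp (by rw [hc]; exact one_ne_zero)
      refine ⟨mul_ne_zero hc0 (by exact_mod_cast (mul_pos hr0 ht).ne'), fun i => ?_⟩
      simp only [norm_mul, hc, one_mul, Complex.norm_real, Real.norm_of_nonneg hr0.le,
        Real.norm_of_nonneg ht.le]
      nlinarith [hle i]
    · have hnr : ‖(r : ℂ)‖ = r := by rw [Complex.norm_real, Real.norm_of_nonneg hr0.le]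
      have hnt : ‖(r : ℂ) * t‖ = r * t := by
        rw [norm_mul, hnr, Complex.norm_real, Real.norm_of_nonneg ht.le]
      have hnrt : ‖(r : ℂ) * t + r‖ = r * t + r := by
        rw [← Complex.ofReal_mul, ← Complex.ofReal_add, Complex.norm_real,
          Real.norm_of_nonneg (by positivity)]
      have hrt : 0 < r * t := mul_pos hr0 ht
      have hit := B.hasSum_iterate_of_product v₁ v₂ (f zt) hφ (z₁ := r * t + r) (z₂ := r)
        (by rw [hnrt, hnr]; linarith) (by rw [add_sub_cancel_right, hnt, hnr]; nlinarith)
        (fun he => by rw [add_eq_right] at he; exact hrt.ne' (by exact_mod_cast he)) s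
        (hasSum_homogeneous (F := fun c => R.eval (iterConf zt (c * (r * t), c * r)))
          (fun c hc => ?_) s)
      · simpa only [add_sub_cancel_right] using hit
      · have h₁ : ‖c * (r : ℂ)‖ < ‖c * ((r : ℂ) * t + r)‖ := by
          rw [norm_mul, norm_mul, hc, hnr, hnrt]
          linarith
        have h₂ : ∀ i, ‖zt i‖ < ‖c * (r : ℂ)‖ := fun i => by
          rw [norm_mul, hc, hnr]
          linarith [hle i]
        have hcf := conf_cons_cons_of_norm_lt hzt h₁ h₂
        have hs := (hconv _ _ zt hcf h₁ h₂ φ hφ).2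
        rw [hR _ hcf] at hs
        rw [iterConf, ← mul_add]
        exact hs
  rw [absConvTo_iff, hR _ hconf]
  have hs := hexp (z₁ - z₂, z₂) ⟨sub_ne_zero.mpr hz₁₂, hz⟩
  simp only [hJ, iterConf, sub_add_cancel] at hs
  exact hs.congr_fun fun k => mul_right_comm _ _ _

end VA
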